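/- arXiv:2303.08712 — 2 statements merged into one kernel-verified Lean document; each statement's English description precedes it below -/
import Mathlib

section
/- Any directed graph G of order n in which every weakly connected component has order at least 4 has a Γ-irregular labeling for every finite abelian group Γ such that the number of involutions of Γ is not equal to 1 and |Γ| ≥ n + 5. -/
open Finset

/-- Weak reachability in a digraph: the reflexive-transitive closure of the
symmetrized adjacency relation. The weakly connected component of `x` is
`{y | WReach Adj x y}`. -/
def WReach {V : Type*} (Adj : V → V → Prop) : V → V → Prop :=
  Relation.ReflTransGen (fun a b => Adj a b ∨ Adj b a)

/-- The induced vertex map `φ_ψ` of an arc labeling `ψ`: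
`φ_ψ(x) = Σ_{y ∈ N⁺(x)} ψ(x,y) − Σ_{y ∈ N⁻(x)} ψ(y,x)`. -/
def vertexSum {V Γ : Type*} [Fintype V] [AddCommGroup Γ]
    (Adj : V → V → Prop) [DecidableRel Adj] (ψ : V → V → Γ) (x : V) : Γ :=
  (∑ y ∈ univ.filter (fun y => Adj x y), ψ x y)
    - (∑ y ∈ univ.filter (fun y => Adj y x), ψ y x)

/-- `G` is realizable in `Γ`: there is a `Γ`-irregular arc labeling, i.e. one whose
induced vertex map is injective. -/
def Realizable {V : Type*} [Fintype V] (Adj : V → V → Prop) [DecidableRel Adj]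
    (Γ : Type*) [AddCommGroup Γ] : Prop :=
  ∃ ψ : V → V → Γ, Function.Injective (vertexSum Adj ψ)

section realize
variable {V Γ : Type*} [Fintype V] [AddCommGroup Γ]

/-- The vertex maps induced by arc labelings form a subgroup. -/
def vertexSumRange (Γ : Type*) [AddCommGroup Γ] (Adj : V → V → Prop) [DecidableRel Adj] :
    AddSubgroup (V → Γ) where
  carrier := {g | ∃ ψ, vertexSum Adj ψ = g}
  zero_mem' := ⟨0, by ext x; simp [vertexSum]⟩
  add_mem' := by
    rintro _ _ ⟨ψ, rfl⟩ ⟨χ, rfl⟩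
    refine ⟨ψ + χ, ?_⟩
    ext x
    simp only [vertexSum, Pi.add_apply, sum_add_distrib]
    abel
  neg_mem' := by
    rintro _ ⟨ψ, rfl⟩
    refine ⟨-ψ, ?_⟩
    ext x
    simp only [vertexSum, Pi.neg_apply, sum_neg_distrib]
    abel

theorem single_sub_single_mem_of_adj [DecidableEq V] (Adj : V → V → Prop) [DecidableRel Adj]
    {x y : V} (h : Adj x y) (γ : Γ) :
    Pi.single x γ - Pi.single y γ ∈ vertexSumRange Γ Adj := by
  refine ⟨fun a b => if a = x ∧ b = y then γ else 0, ?_⟩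
  ext z
  simp only [vertexSum, Pi.sub_apply]
  congr 1
  · by_cases hz : z = x
    · subst hz
      simp [h]
    · simp [hz]
  · by_cases hz : z = y
    · subst hz
      simp [h]
    · simp [hz]

theorem single_sub_single_mem_of_wReach [DecidableEq V] (Adj : V → V → Prop) [DecidableRel Adj]
    {x y : V} (h : WReach Adj x y) (γ : Γ) :
    Pi.single x γ - Pi.single y γ ∈ vertexSumRange Γ Adj := by
  induction h with
  | refl => simp [zero_mem]
  | @tail b c _ hbc ih =>
    have key : Pi.single b γ - Pi.single c γ ∈ vertexSumRange Γ Adj := by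
      rcases hbc with hbc | hbc
      · exact single_sub_single_mem_of_adj Adj hbc γ
      · rw [← neg_sub]
        exact neg_mem (single_sub_single_mem_of_adj Adj hbc γ)
    simpa using add_mem ih key

/-- Weak reachability is an equivalence relation. -/
def wReachSetoid (Adj : V → V → Prop) : Setoid V where
  r := WReach Adj
  iseqv :=
    { refl := fun _ => Relation.ReflTransGen.refl
      symm := fun h => by
        have : Std.Symm (fun a b => Adj a b ∨ Adj b a) := ⟨fun _ _ => Or.symm⟩
        exact Std.Symm.symm (r := Relation.ReflTransGen fun a b => Adj a b ∨ Adj b a) _ _ h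
      trans := fun h h' => Relation.ReflTransGen.trans h h' }

theorem exists_vertexSum_eq (Adj : V → V → Prop) [DecidableRel Adj] (g : V → Γ)
    (hg : ∀ c : Quotient (wReachSetoid Adj), ∑ᶠ x ∈ {x | Quotient.mk _ x = c}, g x = 0) :
    ∃ ψ, vertexSum Adj ψ = g := by
  classical
  let rep : V → V := fun x => (Quotient.mk (wReachSetoid Adj) x).out
  have hmem : ∑ x, (Pi.single x (g x) - Pi.single (rep x) (g x) : V → Γ) ∈
      vertexSumRange Γ Adj := by
    refine sum_mem fun x _ => single_sub_single_mem_of_wReach Adj ?_ _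
    exact (wReachSetoid Adj).symm (Quotient.mk_out (s := wReachSetoid Adj) x)
  have h0 : ∑ x, (Pi.single (rep x) (g x) : V → Γ) = 0 := by
    ext z
    have h1 := hg (Quotient.mk _ z)
    rw [finsum_mem_eq_finite_toFinset_sum _ (Set.toFinite _)] at h1
    simp only [Finset.sum_apply, Pi.zero_apply, Pi.single_apply]
    by_cases hz : z = rep z
    · rw [← sum_filter, ← h1]
      refine sum_congr ?_ fun _ _ => rfl
      ext x
      simp only [mem_filter, mem_univ, true_and, Set.Finite.mem_toFinset, Set.mem_ofPred_eq]
      constructor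
      · intro h
        rw [h]
        exact (Quotient.out_eq _).symm
      · intro h
        rw [hz]
        simp only [rep, h]
    · refine sum_eq_zero fun x _ => if_neg ?_
      rintro h
      apply hz
      have : Quotient.mk (wReachSetoid Adj) z = Quotient.mk _ x := by
        rw [h]; exact Quotient.out_eq _
      simp only [rep, this]
      exact h
  rw [sum_sub_distrib, h0, sub_zero, univ_sum_single] at hmem
  exact hmem

end realize

/-- `Γ` contains pairwise disjoint zero-sum subsets of the prescribed cardinalities. -/
def HasZeroSumFamily (Γ : Type*) [AddCommGroup Γ] {P : Type*} (m : P → ℕ) : Prop :=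
  ∃ S : P → Finset Γ, (∀ p, #(S p) = m p) ∧ (∀ p, ∑ x ∈ S p, x = 0) ∧
    Pairwise fun p q => Disjoint (S p) (S q)

theorem HasZeroSumFamily.exists_injective_vertexSum {V Γ : Type*} [Fintype V] [AddCommGroup Γ]
    (Adj : V → V → Prop) [DecidableRel Adj]
    (h : HasZeroSumFamily Γ
      fun c : Quotient (wReachSetoid Adj) => {x | Quotient.mk _ x = c}.ncard) :
    ∃ ψ : V → V → Γ, Function.Injective (vertexSum Adj ψ) := by
  classical
  obtain ⟨S, hcard, hsum, hdisj⟩ := h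
  have he : ∀ c, Nonempty ({x : V | Quotient.mk (wReachSetoid Adj) x = c} ≃ S c) := fun c => by
    refine ⟨Fintype.equivOfCardEq ?_⟩
    rw [Fintype.card_coe, hcard]
    exact (Set.ncard_eq_toFinset_card' _).trans (Set.toFinset_card _) |>.symm
  obtain ⟨e⟩ := Classical.nonempty_pi.2 he
  let g : V → Γ := fun x => e (Quotient.mk _ x) ⟨x, rfl⟩
  have hge : ∀ c (x : {x : V | Quotient.mk (wReachSetoid Adj) x = c}), g x = e c x := by
    rintro c ⟨x, rfl⟩
    rfl
  have hgmem : ∀ x, g x ∈ S (Quotient.mk _ x) := fun x => (e _ _).2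
  obtain ⟨ψ, hψ⟩ := exists_vertexSum_eq Adj g (fun c => by
    rw [← finsum_set_coe_eq_finsum_mem, finsum_congr (hge c),
      finsum_eq_of_bijective (g := fun y : S c => (y : Γ)) _ (e c).bijective fun _ => rfl,
      finsum_eq_sum_of_fintype]
    exact (sum_coe_sort (S c) fun y => y).trans (hsum c))
  refine ⟨ψ, ?_⟩
  rw [hψ]
  intro x y hxy
  have hc : Quotient.mk (wReachSetoid Adj) x = Quotient.mk _ y := by
    by_contra hne
    exact disjoint_left.1 (hdisj hne) (hgmem x) (hxy ▸ hgmem y)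
  have h2 : e (Quotient.mk _ y) ⟨x, hc⟩ = e (Quotient.mk _ y) ⟨y, rfl⟩ := by
    apply Subtype.ext
    rw [← hge, ← hge]
    exact hxy
  simpa using h2

theorem not_sameCycle_swap_mul {ι : Type*} [Finite ι] [DecidableEq ι] {π : Equiv.Perm ι}
    {p q : ι} (hpq : p ≠ q) (h : π.SameCycle q p) :
    ¬ (Equiv.swap p q * π).SameCycle q p := by
  obtain ⟨n₀, hn₀⟩ := h.exists_nat_pow_eq
  have hex : ∃ n, (π ^ n) q = p := ⟨n₀, hn₀⟩
  classical
  let n := Nat.find hex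
  have hn : (π ^ n) q = p := Nat.find_spec hex
  have hmin : ∀ k, k < n → (π ^ k) q ≠ p := fun k hk => Nat.find_min hex hk
  have hn0 : 0 < n := by
    rcases Nat.eq_zero_or_pos n with h0 | h0
    · rw [h0] at hn
      exact absurd hn.symm hpq
    · exact h0
  have hq : ∀ k, 0 < k → k < n → (π ^ k) q ≠ q := by
    intro k hk hkn hkq
    apply hmin (n - k) (by omega)
    rw [← hn]
    conv_rhs => rw [show n = n - k + k by omega, pow_add, Equiv.Perm.mul_apply, hkq]
  have hagree : ∀ k, k < n → ((Equiv.swap p q * π) ^ k) q = (π ^ k) q := by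
    intro k
    induction k with
    | zero => intro _; rfl
    | succ k ih =>
      intro hk
      rw [pow_succ', Equiv.Perm.mul_apply, ih (by omega), Equiv.Perm.mul_apply,
        ← Equiv.Perm.mul_apply π, ← pow_succ',
        Equiv.swap_apply_of_ne_of_ne (hmin _ hk) (hq _ (by omega) hk)]
  have hret : ((Equiv.swap p q * π) ^ n) q = q := by
    have h1 : n = n - 1 + 1 := by omega
    rw [h1, pow_succ', Equiv.Perm.mul_apply, hagree _ (by omega), Equiv.Perm.mul_apply,
      ← Equiv.Perm.mul_apply π, ← pow_succ', ← h1, hn, Equiv.swap_apply_left]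
  intro hc
  obtain ⟨k, hk⟩ := hc.exists_nat_pow_eq
  have hmod : ((Equiv.swap p q * π) ^ (k % n)) q = p := by
    rw [← Nat.mod_add_div k n, pow_add, pow_mul, Equiv.Perm.mul_apply,
      Equiv.Perm.pow_apply_eq_self_of_apply_eq_self hret] at hk
    exact hk
  rw [hagree _ (Nat.mod_lt _ hn0)] at hmod
  exact hmin _ (Nat.mod_lt _ hn0) hmod

/-- One exchange step: the prescribed sums of two indices may be changed, keeping their total. -/
theorem exists_equiv_add_eq_of_two {ι H : Type*} [Finite ι] [AddCommGroup H]
    {b b' : ι → H} {p q : ι} (hpq : p ≠ q) (hb : ∀ i, i ≠ p → i ≠ q → b' i = b i)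
    (hsum : b' p + b' q = b p + b q) {x y : ι ≃ H} (hxy : ∀ i, x i + y i = b i) :
    ∃ x' y' : ι ≃ H, ∀ i, x' i + y' i = b' i := by
  classical
  have key : ∀ (y : ι ≃ H) (π : Equiv.Perm ι), (∀ i, i ≠ p → i ≠ q → x i + y i = b i) →
      x p + x q + (y p + y q) = b p + b q →
      (∀ i, y (π i) = x i + (b' p - x p - x q)) → ¬ π.SameCycle q p →
      ∃ x' y' : ι ≃ H, ∀ i, x' i + y' i = b' i := by
    intro y π hy hs hyπ hnot
    let C := π.cycleOf q
    have hCp : C p = p := Equiv.Perm.cycleOf_apply_of_not_sameCycle hnot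
    have hCp' : C.symm p = p := by rw [Equiv.symm_apply_eq, hCp]
    have hCq : C q = π q := Equiv.Perm.cycleOf_apply_self _ _
    have hCx : ∀ i, π.SameCycle q i → y i = x (C.symm i) + (b' p - x p - x q) := by
      intro i hi
      have h1 : C (π.symm i) = i := by
        have h2 : π.SameCycle q (π.symm i) := by
          rw [← Equiv.Perm.sameCycle_apply_right]
          simpa using hi
        rw [Equiv.Perm.SameCycle.cycleOf_apply h2, Equiv.apply_symm_apply]
      rw [(Equiv.symm_apply_eq C).2 h1.symm, ← hyπ, Equiv.apply_symm_apply]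
    refine ⟨C.symm.trans x, (Equiv.swap p q).trans (C.trans y), fun i => ?_⟩
    simp only [Equiv.trans_apply]
    by_cases hip : i = p
    · subst hip
      rw [Equiv.swap_apply_left, hCp', hCq, hyπ]
      abel
    by_cases hiq : i = q
    · subst hiq
      have h1 := hCx i (Equiv.Perm.SameCycle.refl _ _)
      rw [Equiv.swap_apply_right, hCp]
      rw [h1] at hs
      have h2 : b' i = b p + b i - b' p := by rw [← hsum]; abel
      rw [h2, ← hs]
      abel
    rw [Equiv.swap_apply_of_ne_of_ne hip hiq, hb i hip hiq, ← hy i hip hiq]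
    by_cases hi : π.SameCycle q i
    · rw [show C i = π i from Equiv.Perm.SameCycle.cycleOf_apply hi, hyπ, hCx i hi]
      abel
    · have h1 : C i = i := Equiv.Perm.cycleOf_apply_of_not_sameCycle hi
      have h2 : C.symm i = i := by rw [Equiv.symm_apply_eq, h1]
      rw [h1, h2]
  let π : Equiv.Perm ι := (x.trans (Equiv.addRight (b' p - x p - x q))).trans y.symm
  have hyπ : ∀ i, y (π i) = x i + (b' p - x p - x q) := fun i => by
    simp [π]
  by_cases hc : π.SameCycle q p
  · refine key ((Equiv.swap p q).trans y) (Equiv.swap p q * π) ?_ ?_ ?_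
      (not_sameCycle_swap_mul hpq hc)
    · intro i hip hiq
      rw [Equiv.trans_apply, Equiv.swap_apply_of_ne_of_ne hip hiq, hxy]
    · rw [Equiv.trans_apply, Equiv.trans_apply, Equiv.swap_apply_left, Equiv.swap_apply_right,
        ← hxy p, ← hxy q]
      abel
    · intro i
      rw [Equiv.trans_apply, Equiv.Perm.mul_apply, Equiv.swap_apply_self, hyπ]
  · refine key y π (fun i _ _ => hxy i) ?_ hyπ hc
    rw [← hxy p, ← hxy q]
    abel

/-- Hall's theorem on abelian groups: any family of `|H|` elements with zero sum is the
termwise sum of two enumerations of `H`. -/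
theorem exists_equiv_add_eq {ι H : Type*} [Fintype ι] [AddCommGroup H] (e : ι ≃ H)
    (b : ι → H) (hb : ∑ i, b i = 0) : ∃ x y : ι ≃ H, ∀ i, x i + y i = b i := by
  classical
  suffices key : ∀ (n : ℕ) (b₀ : ι → H), ∑ i, b₀ i = 0 → #{i | b₀ i ≠ b i} ≤ n →
      (∃ x y : ι ≃ H, ∀ i, x i + y i = b₀ i) → ∃ x y : ι ≃ H, ∀ i, x i + y i = b i from
    key _ 0 (by simp) le_rfl ⟨e, e.trans (Equiv.neg H), fun i => by simp⟩
  intro n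
  induction n with
  | zero =>
    intro b₀ _ hn h
    have : b₀ = b := by
      ext i
      by_contra hi
      have : i ∈ ({i | b₀ i ≠ b i} : Finset ι) := by simpa using hi
      rw [card_eq_zero.1 (Nat.le_zero.1 hn)] at this
      simp at this
    rwa [this] at h
  | succ n ih =>
    intro b₀ hb₀ hn ⟨x, y, hxy⟩
    by_cases hex : ∃ p, b₀ p ≠ b p
    · obtain ⟨p, hp⟩ := hex
      obtain ⟨q, hqp, hq⟩ : ∃ q, q ≠ p ∧ b₀ q ≠ b q := by
        by_contra! hall
        apply hp
        have h1 := hb₀.trans hb.symm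
        rw [← add_sum_erase _ _ (mem_univ p), ← add_sum_erase _ b (mem_univ p),
          sum_congr rfl fun i hi => hall i (ne_of_mem_erase hi)] at h1
        exact add_right_cancel h1
      let b₁ : ι → H := Function.update (Function.update b₀ p (b p)) q (b₀ q + (b₀ p - b p))
      have hb₁p : b₁ p = b p := by simp [b₁, hqp.symm]
      have hb₁q : b₁ q = b₀ q + (b₀ p - b p) := by simp [b₁]
      have hb₁ : ∀ i, i ≠ p → i ≠ q → b₁ i = b₀ i := fun i h1 h2 => by simp [b₁, h1, h2]
      refine ih b₁ ?_ ?_ (exists_equiv_add_eq_of_two hqp.symm hb₁ ?_ hxy)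
      · have hq' : q ∈ univ.erase p := by simp [hqp]
        rw [← hb₀, ← add_sum_erase _ _ (mem_univ p), ← add_sum_erase _ _ hq',
          ← add_sum_erase _ b₀ (mem_univ p), ← add_sum_erase _ b₀ hq', hb₁p, hb₁q,
          sum_congr rfl fun i hi => hb₁ i (by simp at hi; tauto) (by simp at hi; tauto)]
        abel
      · rw [← Nat.lt_succ_iff]
        refine lt_of_lt_of_le (card_lt_card ?_) hn
        rw [Finset.ssubset_iff_of_subset]
        · exact ⟨p, by simpa using hp, by simp [hb₁p]⟩
        · intro i
          simp only [mem_filter, mem_univ, true_and]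
          intro hi
          by_cases hip : i = p
          · rw [hip]; exact hp
          by_cases hiq : i = q
          · rw [hiq]; exact hq
          rwa [hb₁ i hip hiq] at hi
      · rw [hb₁p, hb₁q]
        abel
    · push Not at hex
      exact ⟨x, y, fun i => by rw [hxy, hex]⟩

theorem exists_le_sum_eq {P : Type*} [DecidableEq P] (s : Finset P) (D : P → ℕ) :
    ∀ k ≤ ∑ p ∈ s, D p, ∃ d : P → ℕ, (∀ p, d p ≤ D p) ∧ ∑ p ∈ s, d p = k := by
  induction s using Finset.induction_on with
  | empty =>
    intro k hk
    exact ⟨0, fun _ => Nat.zero_le _, by simpa using (Nat.le_zero.1 hk).symm⟩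
  | insert a s ha ih =>
    intro k hk
    rw [sum_insert ha] at hk
    obtain ⟨d, hd, hs⟩ := ih (k - D a) (by omega)
    refine ⟨Function.update d a (min k (D a)), fun p => ?_, ?_⟩
    · by_cases hp : p = a
      · subst hp; simp
      · simpa [hp] using hd p
    · rw [sum_insert ha, sum_update_of_notMem ha, hs, Function.update_self]
      omega

/-- Parts of size at least 4 and total size `4 * h` can be spread evenly over the four cosets of a
subgroup with Klein quotient, every part meeting the last two nontrivial cosets equally often. -/
theorem exists_coset_distribution {P : Type*} [Fintype P] {m : P → ℕ} {h : ℕ} (hm : ∀ p, 4 ≤ m p)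
    (hsum : ∑ p, m p = 4 * h) :
    ∃ n₀ n w : P → ℕ, (∀ p, n₀ p + 2 * n p + w p = m p) ∧ (∀ p, 1 ≤ n p) ∧
      (∀ p, 2 ∣ n p + w p) ∧ ∑ p, n₀ p = h ∧ ∑ p, n p = h ∧ ∑ p, w p = h := by
  classical
  have hcard : Fintype.card P ≤ h := by
    have h1 := sum_le_sum fun p (_ : p ∈ univ) => hm p
    rw [hsum, sum_const, smul_eq_mul, card_univ] at h1
    omega
  have hlo : ∑ p, m p / 4 ≤ h := by
    have h1 := sum_le_sum fun p (_ : p ∈ univ) => show 4 * (m p / 4) ≤ m p by omega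
    rw [hsum, ← mul_sum] at h1
    omega
  have hhi : h ≤ ∑ p, m p / 4 + ∑ p, min 1 (m p % 4) := by
    have h1 := sum_le_sum fun p (_ : p ∈ univ) =>
      show m p ≤ 4 * (m p / 4 + min 1 (m p % 4)) by omega
    rw [hsum, ← mul_sum, sum_add_distrib] at h1
    omega
  obtain ⟨d, hd, hds⟩ := exists_le_sum_eq univ (fun p => min 1 (m p % 4)) (h - ∑ p, m p / 4)
    (by omega)
  simp only [le_min_iff] at hd
  let n : P → ℕ := fun p => m p / 4 + d p
  have hn : ∀ p, 1 ≤ n p ∧ 2 * n p + n p % 2 ≤ m p := fun p => by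
    have := hm p; have := hd p; simp only [n]; omega
  have hns : ∑ p, n p = h := by simp only [n, sum_add_distrib, hds]; omega
  have hle : ∑ p, n p % 2 ≤ h := by
    rw [← hns]
    exact sum_le_sum fun p _ => Nat.mod_le _ _
  have hpar : (∑ p, n p % 2) % 2 = h % 2 := by rw [← hns, sum_nat_mod univ 2 n]
  have hup : h ≤ ∑ p, n p % 2 + 2 * ∑ p, (m p - 2 * n p - n p % 2) / 2 := by
    have h1 := sum_le_sum fun p (_ : p ∈ univ) =>
      show m p ≤ 2 * n p + n p % 2 + 2 * ((m p - 2 * n p - n p % 2) / 2) + 1 by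
        have := hn p; omega
    simp only [sum_add_distrib, hsum, ← mul_sum, hns, sum_const, card_univ, smul_eq_mul] at h1
    omega
  obtain ⟨e, he, hes⟩ := exists_le_sum_eq univ (fun p => (m p - 2 * n p - n p % 2) / 2)
    ((h - ∑ p, n p % 2) / 2) (by omega)
  have hw : ∑ p, (n p % 2 + 2 * e p) = h := by
    rw [sum_add_distrib, ← mul_sum, hes]
    omega
  have hall : ∀ p, m p - 2 * n p - (n p % 2 + 2 * e p) + 2 * n p + (n p % 2 + 2 * e p) = m p :=
    fun p => by have := hn p; have := he p; omega
  refine ⟨fun p => m p - 2 * n p - (n p % 2 + 2 * e p), n, fun p => n p % 2 + 2 * e p, hall,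
    fun p => (hn p).1, fun p => by dsimp only; omega, ?_, hns, hw⟩
  have h1 : ∑ p, (m p - 2 * n p - (n p % 2 + 2 * e p) + 2 * n p + (n p % 2 + 2 * e p)) = 4 * h := by
    rw [← hsum]
    exact sum_congr rfl fun p _ => hall p
  rw [sum_add_distrib, hw, sum_add_distrib, ← mul_sum, hns] at h1
  dsimp only
  omega

theorem exists_index_four {Γ : Type*} [AddCommGroup Γ] [Fintype Γ]
    (h : 2 ≤ {ι : Γ | ι ≠ 0 ∧ ι + ι = 0}.ncard) :
    ∃ (H : AddSubgroup Γ) (a b : Γ), Fintype.card Γ = 4 * Nat.card H ∧ a ∉ H ∧ b ∉ H ∧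
      a + b ∉ H ∧ a + a ∈ H ∧ b + b ∈ H := by
  classical
  let T : AddSubgroup Γ := (nsmulAddMonoidHom (α := Γ) 2).range
  have hT : ∀ x : Γ ⧸ T, 2 • x = 0 := by
    intro x
    obtain ⟨y, rfl⟩ := QuotientAddGroup.mk_surjective x
    rw [← QuotientAddGroup.mk_nsmul, QuotientAddGroup.eq_zero_iff]
    exact ⟨y, rfl⟩
  have hcard : 3 ≤ Nat.card (Γ ⧸ T) := by
    have h1 := T.card_eq_card_quotient_mul_card_addSubgroup
    have h2 := (nsmulAddMonoidHom (α := Γ) 2).ker.card_eq_card_quotient_mul_card_addSubgroup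
    rw [Nat.card_congr
        (QuotientAddGroup.quotientKerEquivRange (nsmulAddMonoidHom (α := Γ) 2)).toEquiv,
      h1, mul_comm] at h2
    have h3 : Nat.card (Γ ⧸ T) = Nat.card (nsmulAddMonoidHom (α := Γ) 2).ker :=
      Nat.eq_of_mul_eq_mul_left Nat.card_pos h2
    rw [h3]
    have h4 : ((nsmulAddMonoidHom (α := Γ) 2).ker : Set Γ) =
        insert 0 {ι : Γ | ι ≠ 0 ∧ ι + ι = 0} := by
      ext x
      simp only [SetLike.mem_coe, AddMonoidHom.mem_ker, nsmulAddMonoidHom_apply, two_nsmul,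
        Set.mem_insert_iff, Set.mem_ofPred_eq]
      by_cases hx : x = 0 <;> simp [hx]
    have h5 := congrArg Set.ncard h4
    rw [Set.ncard_insert_of_notMem (by simp)] at h5
    change 3 ≤ ((nsmulAddMonoidHom (α := Γ) 2).ker : Set Γ).ncard
    omega
  let _ : Module (ZMod 2) (Γ ⧸ T) := AddCommGroup.zmodModule hT
  have hrank : 2 ≤ Module.finrank (ZMod 2) (Γ ⧸ T) := by
    by_contra hlt
    have h1 := Module.natCard_eq_pow_finrank (K := ZMod 2) (V := Γ ⧸ T)
    rw [Nat.card_zmod] at h1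
    have h2 : 2 ^ Module.finrank (ZMod 2) (Γ ⧸ T) ≤ 2 ^ 1 :=
      Nat.pow_le_pow_right (by norm_num) (by omega)
    omega
  obtain ⟨v, hv⟩ := exists_linearIndependent_of_le_finrank hrank
  obtain ⟨g, hg⟩ := LinearMap.exists_leftInverse_of_injective (Fintype.linearCombination (ZMod 2) v)
    (by rw [LinearMap.ker_eq_bot]; exact hv.fintypeLinearCombination_injective)
  have hg' : Function.Surjective g := fun y => ⟨_, LinearMap.congr_fun hg y⟩
  let φ : Γ →+ (Fin 2 → ZMod 2) := g.toAddMonoidHom.comp (QuotientAddGroup.mk' T)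
  have hφ : Function.Surjective φ := hg'.comp (QuotientAddGroup.mk'_surjective T)
  obtain ⟨a, ha⟩ := hφ ![1, 0]
  obtain ⟨b, hb⟩ := hφ ![0, 1]
  refine ⟨φ.ker, a, b, ?_, ?_, ?_, ?_, ?_, ?_⟩
  · rw [← Nat.card_eq_fintype_card, φ.ker.card_eq_card_quotient_mul_card_addSubgroup,
      Nat.card_congr (QuotientAddGroup.quotientKerEquivOfSurjective φ hφ).toEquiv]
    simp
  all_goals
    rw [AddMonoidHom.mem_ker]
    try rw [map_add]
    simp only [ha, hb]
    decide

theorem hasZeroSumFamily_of_injective {Γ P : Type*} [AddCommGroup Γ] {m : P → ℕ}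
    {σ : P → Type*} [∀ p, Fintype (σ p)] (F : (p : P) → σ p → Γ)
    (hcard : ∀ p, Fintype.card (σ p) = m p) (hsum : ∀ p, ∑ s, F p s = 0)
    (hF : Function.Injective fun s : Σ p, σ p => F s.1 s.2) : HasZeroSumFamily Γ m := by
  classical
  have hinj : ∀ p, Function.Injective (F p) := fun p s t h => by
    have := @hF ⟨p, s⟩ ⟨p, t⟩ h
    simpa using this
  refine ⟨fun p => univ.image (F p), fun p => ?_, fun p => ?_, fun p q hpq => ?_⟩
  · rw [card_image_of_injective _ (hinj p), card_univ, hcard]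
  · rw [sum_image fun _ _ _ _ h => hinj p h, hsum]
  · refine disjoint_left.2 fun x hx hx' => ?_
    obtain ⟨s, -, rfl⟩ := mem_image.1 hx
    obtain ⟨t, -, ht⟩ := mem_image.1 hx'
    exact hpq (congrArg Sigma.fst (@hF ⟨q, t⟩ ⟨p, s⟩ ht)).symm

theorem hasZeroSumFamily_of_index_four {Γ P : Type*} [AddCommGroup Γ] [Fintype Γ] [Fintype P]
    {m : P → ℕ} (hm : ∀ p, 4 ≤ m p) (hsum : ∑ p, m p = Fintype.card Γ) {H : AddSubgroup Γ}
    {a b : Γ} (hcard : Fintype.card Γ = 4 * Nat.card H) (ha : a ∉ H) (hb : b ∉ H)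
    (hab : a + b ∉ H) (haa : a + a ∈ H) (hbb : b + b ∈ H) : HasZeroSumFamily Γ m := by
  classical
  obtain ⟨n₀, n, w, hall, hn, hnw, hs₀, hs, hsw⟩ :=
    exists_coset_distribution hm (hsum.trans hcard)
  choose u hu using hnw
  have hus : ∑ p, u p = Nat.card H := by
    have h1 : ∑ p, (n p + w p) = ∑ p, 2 * u p := sum_congr rfl fun p _ => hu p
    rw [sum_add_distrib, ← mul_sum, hs, hsw] at h1
    omega
  have hequiv : ∀ k : P → ℕ, ∑ p, k p = Nat.card H → Nonempty ((Σ p, Fin (k p)) ≃ H) :=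
    fun k hk => ⟨Fintype.equivOfCardEq (by simp [hk, Nat.card_eq_fintype_card])⟩
  obtain ⟨e₀⟩ := hequiv n₀ hs₀
  obtain ⟨e⟩ := hequiv n hs
  obtain ⟨e'⟩ := hequiv w hsw
  let c : H := ⟨a + a, haa⟩ + ⟨b + b, hbb⟩
  let T : P → H := fun p => -(∑ i, e₀ ⟨p, i⟩ + ∑ i, e' ⟨p, i⟩) - u p • c
  have hT : ∀ p, ∑ j : Fin (n p), (if j = ⟨0, hn p⟩ then T p else 0) = T p := fun p => by simp
  have hT0 : ∑ p, T p = 0 := by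
    have h1 : ∀ (k : P → ℕ) (f : (Σ p, Fin (k p)) ≃ H), ∑ p, ∑ i, f ⟨p, i⟩ = ∑ x, x :=
      fun k f => by
        rw [← Fintype.sum_sigma' fun p i => f ⟨p, i⟩]
        exact f.sum_comp fun x => x
    have h2 : ∑ x : H, x + ∑ x : H, x = 0 := by
      have h3 : ∑ x : H, -x = ∑ x : H, x := Equiv.sum_comp (Equiv.neg H) fun x => x
      nth_rewrite 2 [← h3]
      rw [sum_neg_distrib, add_neg_cancel]
    simp only [T, sum_sub_distrib, sum_neg_distrib, sum_add_distrib, h1, h2]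
    rw [← sum_smul, hus]
    simp
  obtain ⟨x, y, hxy⟩ := exists_equiv_add_eq e
    (fun s => if s.2 = ⟨0, hn s.1⟩ then T s.1 else 0) (by
      rw [Fintype.sum_sigma]
      simp only [hT, hT0])
  refine hasZeroSumFamily_of_injective
    (σ := fun p => Fin (n₀ p) ⊕ Fin (n p) ⊕ Fin (n p) ⊕ Fin (w p))
    (fun p => Sum.elim (fun i => (e₀ ⟨p, i⟩ : Γ)) <| Sum.elim (fun i => a + x ⟨p, i⟩) <|
      Sum.elim (fun i => b + y ⟨p, i⟩) fun i => a + b + e' ⟨p, i⟩) ?_ ?_ ?_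
  · intro p
    simp only [Fintype.card_sum, Fintype.card_fin]
    have := hall p
    omega
  · intro p
    have h1 : ∑ i, x ⟨p, i⟩ + ∑ i, y ⟨p, i⟩ = T p := by
      rw [← sum_add_distrib, ← hT p]
      exact sum_congr rfl fun i _ => hxy ⟨p, i⟩
    have h2 := congrArg (fun z : H => (z : Γ)) h1
    have h3 : n p • (a + b) + w p • (a + b) = u p • (a + a + (b + b)) := by
      rw [← add_nsmul, hu, mul_comm, mul_nsmul', two_nsmul]
      congr 1
      abel
    simp only [T, c, AddSubgroup.coe_add, AddSubgroup.coe_sub, AddSubgroup.coe_neg,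
      AddSubgroup.val_finsetSum, AddSubgroup.coe_nsmul] at h2
    simp only [Fintype.sum_sum_type, Sum.elim_inl, Sum.elim_inr, sum_add_distrib, sum_const,
      card_univ, Fintype.card_fin]
    rw [← h3] at h2
    have h4 := eq_sub_iff_add_eq.1 h2
    simp only [nsmul_add] at h4 ⊢
    rw [← sub_eq_zero] at h4
    rw [← h4]
    abel
  · have key : ∀ (z : Γ) (s t : H), z + s = t → z ∈ H := fun z s t h => by
      rw [← eq_sub_iff_add_eq] at h
      rw [h]
      exact sub_mem t.2 s.2
    have key' : ∀ s t : H, a + s ≠ b + t := fun s t h => by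
      refine hab (key _ s (⟨b + b, hbb⟩ + t) ?_)
      rw [add_right_comm, h]
      change b + (t : Γ) + b = b + b + t
      abel
    have hinj : ∀ (k : P → ℕ) (f : (Σ p, Fin (k p)) ≃ H) (p q : P) (i : Fin (k p))
        (j : Fin (k q)), (f ⟨p, i⟩ : Γ) = f ⟨q, j⟩ → (⟨p, i⟩ : Σ p, Fin (k p)) = ⟨q, j⟩ :=
      fun k f p q i j h => f.injective (Subtype.ext h)
    rintro ⟨p, i | i | i | i⟩ ⟨q, j | j | j | j⟩ h <;>
      simp only [Sum.elim_inl, Sum.elim_inr] at h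
    · cases hinj _ _ _ _ _ _ h; rfl
    · exact (ha (key _ _ _ h.symm)).elim
    · exact (hb (key _ _ _ h.symm)).elim
    · exact (hab (key _ _ _ h.symm)).elim
    · exact (ha (key _ _ _ h)).elim
    · cases hinj _ _ _ _ _ _ (add_left_cancel h); rfl
    · exact (key' _ _ h).elim
    · rw [add_assoc, add_right_inj] at h
      exact (hb (key _ _ _ h.symm)).elim
    · exact (hb (key _ _ _ h)).elim
    · exact (key' _ _ h.symm).elim
    · cases hinj _ _ _ _ _ _ (add_left_cancel h); rfl
    · rw [add_comm a, add_assoc, add_right_inj] at h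
      exact (ha (key _ _ _ h.symm)).elim
    · exact (hab (key _ _ _ h)).elim
    · rw [add_assoc, add_right_inj] at h
      exact (hb (key _ _ _ h)).elim
    · rw [add_comm a, add_assoc, add_right_inj] at h
      exact (ha (key _ _ _ h)).elim
    · cases hinj _ _ _ _ _ _ (add_left_cancel h); rfl

/-- A family of zero-sum triples whose entries are nonzero and pairwise distinct up to sign. -/
def IsTripleSystem {ι Γ : Type*} [AddCommGroup Γ] (f : ι → Fin 3 → Γ) : Prop :=
  (∀ i, ∑ j, f i j = 0) ∧ (∀ i j, f i j ≠ 0) ∧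
    ∀ i j i' j', f i j = f i' j' ∨ f i j = -f i' j' → i = i' ∧ j = j'

namespace IsTripleSystem
variable {ι κ Γ : Type*} [AddCommGroup Γ] {f : ι → Fin 3 → Γ}

theorem comp (hf : IsTripleSystem f) {e : κ → ι} (he : Function.Injective e) :
    IsTripleSystem (f ∘ e) :=
  ⟨fun i => hf.1 (e i), fun i => hf.2.1 (e i), fun i j i' j' h =>
    let ⟨h1, h2⟩ := hf.2.2 (e i) j (e i') j' h
    ⟨he h1, h2⟩⟩

theorem option (hf : IsTripleSystem f) {a b c : Γ} (habc : a + b + c = 0)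
    (ha : ∀ i j, a ≠ f i j ∧ a ≠ -f i j) (hb : ∀ i j, b ≠ f i j ∧ b ≠ -f i j)
    (hc : ∀ i j, c ≠ f i j ∧ c ≠ -f i j) (ha0 : a ≠ 0) (hb0 : b ≠ 0) (hc0 : c ≠ 0)
    (hab : a ≠ b) (hac : a ≠ c) (hbc : b ≠ c) :
    IsTripleSystem fun o : Option ι => o.elim ![a, b, c] f := by
  have hab' : a ≠ -b := fun h => hc0 (by simpa [h] using habc)
  have hac' : a ≠ -c := fun h => hb0 (by simpa [h] using habc)
  have hbc' : b ≠ -c := fun h => ha0 (by simpa [h, add_assoc] using habc)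
  have key : ∀ (j : Fin 3) i j', ![a, b, c] j ≠ f i j' ∧ ![a, b, c] j ≠ -f i j' := by
    intro j i j'
    fin_cases j
    · exact ha i j'
    · exact hb i j'
    · exact hc i j'
  refine ⟨?_, ?_, ?_⟩
  · rintro (_ | i)
    · simpa [Fin.sum_univ_three] using habc
    · exact hf.1 i
  · rintro (_ | i) j
    · fin_cases j <;> simpa
    · exact hf.2.1 i j
  · rintro (_ | i) j (_ | i') j' h
    · refine ⟨rfl, ?_⟩
      fin_cases j <;> fin_cases j' <;>
        simp_all [eq_comm, neg_eq_iff_eq_neg]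
    · rcases h with h | h
      · exact ((key j i' j').1 h).elim
      · exact ((key j i' j').2 h).elim
    · rcases h with h | h
      · exact ((key j' i j).1 h.symm).elim
      · exact ((key j' i j).2 (neg_eq_iff_eq_neg.2 h).symm).elim
    · obtain ⟨rfl, rfl⟩ := hf.2.2 i j i' j' h
      exact ⟨rfl, rfl⟩

end IsTripleSystem

section free
variable {ι Γ : Type*} [AddCommGroup Γ] [Fintype Γ] {f : ι → Fin 3 → Γ}

open Classical in
/-- The nonzero elements that are not, up to sign, entries of the triples `f`. -/
noncomputable def freeElements (f : ι → Fin 3 → Γ) : Finset Γ :=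
  {a | a ≠ 0 ∧ ∀ i j, a ≠ f i j ∧ a ≠ -f i j}

theorem mem_freeElements {a : Γ} :
    a ∈ freeElements f ↔ a ≠ 0 ∧ ∀ i j, a ≠ f i j ∧ a ≠ -f i j := by
  simp [freeElements]

theorem neg_mem_freeElements {a : Γ} (ha : a ∈ freeElements f) : -a ∈ freeElements f := by
  rw [mem_freeElements] at ha ⊢
  refine ⟨neg_ne_zero.2 ha.1, fun i j => ⟨fun h => (ha.2 i j).2 ?_, fun h => (ha.2 i j).1 ?_⟩⟩
  · rw [← h, neg_neg]
  · exact neg_injective h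

theorem IsTripleSystem.sum_univ_eq [Fintype ι] (h2 : ∀ x : Γ, x + x = 0 → x = 0)
    (hf : IsTripleSystem f) (F : Γ → ℕ) :
    ∑ u, F u = F 0 + ∑ u ∈ freeElements f, F u + ∑ i, ∑ j, (F (f i j) + F (-f i j)) := by
  classical
  let g : (ι × Fin 3) ⊕ (ι × Fin 3) → Γ := Sum.elim (fun s => f s.1 s.2) fun s => -f s.1 s.2
  have hself : ∀ i j i' j', f i j ≠ -f i' j' := fun i j i' j' h => by
    obtain ⟨rfl, rfl⟩ := hf.2.2 i j i' j' (Or.inr h)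
    exact hf.2.1 i j (h2 _ (eq_neg_iff_add_eq_zero.1 h))
  have hg : Function.Injective g := by
    rintro (⟨i, j⟩ | ⟨i, j⟩) (⟨i', j'⟩ | ⟨i', j'⟩) h
    · obtain ⟨rfl, rfl⟩ := hf.2.2 i j i' j' (Or.inl h)
      rfl
    · exact (hself _ _ _ _ h).elim
    · exact (hself _ _ _ _ h.symm).elim
    · obtain ⟨rfl, rfl⟩ := hf.2.2 i j i' j' (Or.inl (neg_injective h))
      rfl
  have h0 : (0 : Γ) ∉ univ.image g := by
    simp only [mem_image, mem_univ, true_and, not_exists, g]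
    rintro (⟨i, j⟩ | ⟨i, j⟩) h
    · exact hf.2.1 i j h
    · exact hf.2.1 i j (neg_eq_zero.1 h)
  have hcompl : (freeElements f)ᶜ = insert 0 (univ.image g) := by
    ext u
    simp only [mem_compl, mem_freeElements, mem_insert, mem_image, mem_univ, true_and,
      Sum.exists, Prod.exists, g, Sum.elim_inl, Sum.elim_inr]
    constructor
    · intro h
      by_contra! hu
      exact h ⟨hu.1, fun i j => ⟨(hu.2.1 i j).symm, (hu.2.2 i j).symm⟩⟩
    · rintro (h | ⟨i, j, h⟩ | ⟨i, j, h⟩) ⟨h0, h1⟩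
      · exact h0 h
      · exact (h1 i j).1 h.symm
      · exact (h1 i j).2 h.symm
  rw [← sum_add_sum_compl (freeElements f), hcompl, sum_insert h0,
    sum_image fun _ _ _ _ h => hg h, Fintype.sum_sum_type]
  simp only [g, Sum.elim_inl, Sum.elim_inr, Fintype.sum_prod_type, sum_add_distrib]
  ring

theorem IsTripleSystem.card_freeElements [Fintype ι] (h2 : ∀ x : Γ, x + x = 0 → x = 0)
    (hf : IsTripleSystem f) :
    Fintype.card Γ = #(freeElements f) + 6 * Fintype.card ι + 1 := by
  have := hf.sum_univ_eq h2 fun _ => 1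
  simp at this
  omega

end free

theorem eq_of_add_self_eq {Γ : Type*} [AddCommGroup Γ] (h2 : ∀ x : Γ, x + x = 0 → x = 0) {a b : Γ}
    (h : a + a = b + b) : a = b := by
  refine sub_eq_zero.1 (h2 _ ?_)
  rw [sub_add_sub_comm, h, sub_self]

theorem exists_add_self_eq {Γ : Type*} [AddCommGroup Γ] [Finite Γ]
    (h2 : ∀ x : Γ, x + x = 0 → x = 0) (u : Γ) : ∃ a, a + a = u :=
  (Finite.injective_iff_surjective (f := fun a : Γ => a + a)).1
    (fun _ _ h => eq_of_add_self_eq h2 h) u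

section extend
variable {ι Γ : Type*} [AddCommGroup Γ] {f : ι → Fin 3 → Γ}

open Classical in
/-- The elements `a` of `A` for which `u = a + b` with `b` in `A`. -/
noncomputable def summands (A : Finset Γ) (u : Γ) : Finset Γ :=
  {a ∈ A | u - a ∈ A}

theorem mem_summands {A : Finset Γ} {u a : Γ} : a ∈ summands A u ↔ a ∈ A ∧ u - a ∈ A := by
  simp [summands]

theorem card_summands_le (A : Finset Γ) (u : Γ) : #(summands A u) ≤ #A := by
  classical
  exact card_le_card fun a ha => (mem_summands.1 ha).1

variable [Fintype Γ]

theorem sum_card_summands (A : Finset Γ) : ∑ u, #(summands A u) = #A * #A := by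
  classical
  simp only [summands, card_filter]
  rw [sum_comm]
  have h : ∀ a : Γ, ∑ u, (if u - a ∈ A then 1 else 0) = #A := fun a => by
    have := Equiv.sum_comp (Equiv.subRight a) fun u => if u ∈ A then 1 else 0
    simpa using this
  simp [h]

theorem card_summands_neg (f : ι → Fin 3 → Γ) (u : Γ) :
    #(summands (freeElements f) (-u)) = #(summands (freeElements f) u) := by
  have h : ∀ u a : Γ, a ∈ summands (freeElements f) u → -a ∈ summands (freeElements f) (-u) := by
    intro u a ha
    rw [mem_summands] at ha ⊢
    refine ⟨neg_mem_freeElements ha.1, ?_⟩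
    convert neg_mem_freeElements ha.2 using 1
    abel
  refine card_nbij' Neg.neg Neg.neg ?_ (h u) (fun a _ => neg_neg a) (fun a _ => neg_neg a)
  intro a ha
  simpa using h _ a ha

theorem card_summands_le_three (h2 : ∀ x : Γ, x + x = 0 → x = 0) (hf : IsTripleSystem f)
    (hext : ∀ g : Option ι → Fin 3 → Γ, ¬ IsTripleSystem g) {d : Γ} (hd : d ∈ freeElements f) :
    #(summands (freeElements f) d) ≤ 3 := by
  classical
  obtain ⟨c, hc⟩ := exists_add_self_eq h2 d
  refine (card_le_card (t := {-d, d + d, c}) fun a ha => ?_).trans card_le_three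
  obtain ⟨ha, hb⟩ := mem_summands.1 ha
  have hd' := neg_mem_freeElements hd
  simp only [mem_insert, mem_singleton]
  by_contra! h
  rw [mem_freeElements] at ha hb hd'
  refine hext _ (hf.option (a := a) (b := d - a) (c := -d) (by abel) ha.2 hb.2 hd'.2 ha.1 hb.1 hd'.1
    (fun h' => h.2.2 (eq_of_add_self_eq h2 ?_)) h.1 fun h' => h.2.1 ?_)
  · rw [hc, ← eq_sub_iff_add_eq, ← h']
  · rw [sub_eq_iff_eq_add] at h'
    rw [← sub_eq_zero, ← neg_eq_zero, neg_sub]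
    nth_rewrite 1 [h']
    abel

/-- One triple can be exchanged for two triples that each contain one of its entries. -/
theorem IsTripleSystem.exists_option_of_exchange (hf : IsTripleSystem f) (i : ι) {j j' : Fin 3}
    (hj : j ≠ j') {a b a' b' : Γ} (ha : a ∈ freeElements f) (hb : b ∈ freeElements f)
    (ha' : a' ∈ freeElements f) (hb' : b' ∈ freeElements f) (hab : a + b = f i j)
    (hab' : a' + b' = f i j') (hne : a ≠ b) (hne' : a' ≠ b')
    (h1 : a' ≠ a ∧ a' ≠ -a ∧ a' ≠ b ∧ a' ≠ -b) (h2 : b' ≠ a ∧ b' ≠ -a ∧ b' ≠ b ∧ b' ≠ -b) :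
    ∃ g : Option ι → Fin 3 → Γ, IsTripleSystem g := by
  classical
  have hi : ∀ (i' : {i' // i' ≠ i}) j' j, f i j ≠ f i' j' ∧ f i j ≠ -f i' j' := fun i' j' j =>
    ⟨fun h => i'.2 (hf.2.2 _ _ _ _ (Or.inl h)).1.symm,
      fun h => i'.2 (hf.2.2 _ _ _ _ (Or.inr h)).1.symm⟩
  have hjj : f i j' ≠ f i j ∧ f i j' ≠ -f i j :=
    ⟨fun h => hj (hf.2.2 _ _ _ _ (Or.inl h)).2.symm,
      fun h => hj (hf.2.2 _ _ _ _ (Or.inr h)).2.symm⟩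
  have na := mem_freeElements.1 (neg_mem_freeElements ha)
  have nb := mem_freeElements.1 (neg_mem_freeElements hb)
  have na' := mem_freeElements.1 (neg_mem_freeElements ha')
  have nb' := mem_freeElements.1 (neg_mem_freeElements hb')
  have pa := mem_freeElements.1 ha
  have pb := mem_freeElements.1 hb
  have pa' := mem_freeElements.1 ha'
  have pb' := mem_freeElements.1 hb'
  have g₁ := (hf.comp (Subtype.val_injective (p := fun i' => i' ≠ i))).option
    (a := f i j) (b := -a) (c := -b) (by rw [← hab]; abel) (fun i' j' => hi i' j' _)
    (fun _ _ => na.2 _ _) (fun _ _ => nb.2 _ _) (hf.2.1 _ _) na.1 nb.1 (na.2 _ _).1.symm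
    (nb.2 _ _).1.symm (fun h => hne (neg_injective h))
  have g₂ := g₁.option
    (a := f i j') (b := -a') (c := -b') (by rw [← hab']; abel) ?_ ?_ ?_
    (hf.2.1 _ _) na'.1 nb'.1 (na'.2 _ _).1.symm
    (nb'.2 _ _).1.symm (fun h => hne' (neg_injective h))
  · exact ⟨_, g₂.comp (Equiv.optionCongr (Equiv.optionSubtypeNe i)).symm.injective⟩
  · rintro (_ | i') l
    · fin_cases l
      · exact hjj
      · exact ⟨(na.2 _ _).1.symm, by simpa using (pa.2 i j').1.symm⟩
      · exact ⟨(nb.2 _ _).1.symm, by simpa using (pb.2 i j').1.symm⟩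
    · exact hi i' l _
  · rintro (_ | i') l
    · fin_cases l
      · exact na'.2 i j
      · exact ⟨fun h => h1.1 (neg_injective h), fun h => h1.2.1 (neg_injective h)⟩
      · exact ⟨fun h => h1.2.2.1 (neg_injective h), fun h => h1.2.2.2 (neg_injective h)⟩
    · exact na'.2 i' l
  · rintro (_ | i') l
    · fin_cases l
      · exact nb'.2 i j
      · exact ⟨fun h => h2.1 (neg_injective h), fun h => h2.2.1 (neg_injective h)⟩
      · exact ⟨fun h => h2.2.2.1 (neg_injective h), fun h => h2.2.2.2 (neg_injective h)⟩
    · exact nb'.2 i' l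

theorem card_summands_le_one_or_le_nine (h2 : ∀ x : Γ, x + x = 0 → x = 0) (hf : IsTripleSystem f)
    (hext : ∀ g : Option ι → Fin 3 → Γ, ¬ IsTripleSystem g) (i : ι) {j j' : Fin 3} (hj : j ≠ j') :
    #(summands (freeElements f) (f i j)) ≤ 1 ∨ #(summands (freeElements f) (f i j')) ≤ 9 := by
  classical
  by_contra! h
  obtain ⟨c, hc⟩ := exists_add_self_eq h2 (f i j)
  obtain ⟨c', hc'⟩ := exists_add_self_eq h2 (f i j')
  obtain ⟨a, ha, hac⟩ := exists_mem_ne h.1 c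
  obtain ⟨ha, hb⟩ := mem_summands.1 ha
  set b := f i j - a with hb_def
  set y := f i j' with hy
  have hcard : #({c'} ∪ ({a, -a, b, -b} ∪ {y - a, y + a, y - b, y + b}) : Finset Γ) ≤ 9 := by
    refine (card_union_le _ _).trans ?_
    have h1 := card_union_le ({a, -a, b, -b} : Finset Γ) {y - a, y + a, y - b, y + b}
    have h3 : #({a, -a, b, -b} : Finset Γ) ≤ 4 := card_le_four
    have h4 : #({y - a, y + a, y - b, y + b} : Finset Γ) ≤ 4 := card_le_four
    rw [card_singleton]
    omega
  obtain ⟨a', ha', hn⟩ := exists_mem_notMem_of_card_lt_card (hcard.trans_lt h.2)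
  obtain ⟨ha', hb'⟩ := mem_summands.1 ha'
  simp only [mem_union, mem_insert, mem_singleton, not_or] at hn
  obtain ⟨hn1, ⟨hn2, hn3, hn4, hn5⟩, hn6, hn7, hn8, hn9⟩ := hn
  obtain ⟨g, hg⟩ := hf.exists_option_of_exchange i hj ha hb ha' hb' (by simp [b])
    (add_sub_cancel a' y)
    (fun h => hac (eq_of_add_self_eq h2 (by rw [hc, ← eq_sub_iff_add_eq]; exact h)))
    (fun h => hn1 (eq_of_add_self_eq h2 (by rw [hc', ← eq_sub_iff_add_eq]; exact h)))
    ⟨hn2, hn3, hn4, hn5⟩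
    ⟨fun h => hn6 (by rw [← h]; abel), fun h => hn7 (by rw [← neg_eq_iff_eq_neg.2 h]; abel),
      fun h => hn8 (by rw [← h]; abel), fun h => hn9 (by rw [← neg_eq_iff_eq_neg.2 h]; abel)⟩
  exact hext g hg

theorem sum_card_summands_triple_le (h2 : ∀ x : Γ, x + x = 0 → x = 0) (hf : IsTripleSystem f)
    (hext : ∀ g : Option ι → Fin 3 → Γ, ¬ IsTripleSystem g) (i : ι) :
    ∑ j, #(summands (freeElements f) (f i j)) ≤ #(freeElements f) + 27 := by
  have h := fun j j' hj => card_summands_le_one_or_le_nine h2 hf hext i (j := j) (j' := j') hj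
  have hle := fun j => card_summands_le (freeElements f) (f i j)
  rw [Fin.sum_univ_three]
  have h01 := h 0 1 (by decide)
  have h10 := h 1 0 (by decide)
  have h02 := h 0 2 (by decide)
  have h20 := h 2 0 (by decide)
  have h12 := h 1 2 (by decide)
  have h21 := h 2 1 (by decide)
  have h0 := hle 0
  have h1 := hle 1
  have h2 := hle 2
  omega

/-- A triple system that is small compared to the group can be enlarged: otherwise the free elements
would have too few pairwise sums. -/
theorem IsTripleSystem.exists_option [Fintype ι] (h2 : ∀ x : Γ, x + x = 0 → x = 0)
    (hf : IsTripleSystem f) (hcard : 10 * (Fintype.card ι + 1) + 5 ≤ Fintype.card Γ) :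
    ∃ g : Option ι → Fin 3 → Γ, IsTripleSystem g := by
  by_contra! hext
  have hN := hf.card_freeElements h2
  have hsum := hf.sum_univ_eq h2 fun u => #(summands (freeElements f) u)
  simp only [card_summands_neg, sum_card_summands] at hsum
  have h0 := card_summands_le (freeElements f) 0
  have h1 : ∑ u ∈ freeElements f, #(summands (freeElements f) u) ≤ #(freeElements f) * 3 :=
    sum_le_card_nsmul _ _ _ fun d hd => card_summands_le_three h2 hf hext hd
  have h3 : ∑ i, ∑ j, (#(summands (freeElements f) (f i j)) + #(summands (freeElements f) (f i j)))
      ≤ Fintype.card ι * (2 * (#(freeElements f) + 27)) := by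
    refine sum_le_card_nsmul _ _ _ fun i _ => ?_
    rw [sum_add_distrib]
    have := sum_card_summands_triple_le h2 hf hext i
    omega
  nlinarith

/-- In a group without involutions, triple systems exist as soon as the group is large enough. -/
theorem exists_isTripleSystem (h2 : ∀ x : Γ, x + x = 0 → x = 0) (k : ℕ)
    (hk : 10 * k + 5 ≤ Fintype.card Γ) : ∃ f : Fin k → Fin 3 → Γ, IsTripleSystem f := by
  induction k with
  | zero => exact ⟨fun i => i.elim0, fun i => i.elim0, fun i => i.elim0, fun i => i.elim0⟩
  | succ k ih =>
    obtain ⟨f, hf⟩ := ih (by omega)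
    obtain ⟨g, hg⟩ := hf.exists_option h2 (by rw [Fintype.card_fin]; omega)
    exact ⟨_, hg.comp (finSuccEquiv k).injective⟩

end extend

/-- Disjoint zero-sum sets of odd size at most 3, and the symmetric set of unused elements. -/
theorem exists_odd_zeroSum_cores {κ Γ : Type*} [Fintype κ] [AddCommGroup Γ] [Fintype Γ]
    (h2 : ∀ x : Γ, x + x = 0 → x = 0) (hκ : 5 * Fintype.card κ + 5 ≤ Fintype.card Γ) :
    ∃ (C : κ → Finset Γ) (A : Finset Γ), (∀ r, Odd #(C r) ∧ #(C r) ≤ 3) ∧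
      (∀ r, ∑ x ∈ C r, x = 0) ∧ (Pairwise fun r r' => Disjoint (C r) (C r')) ∧
      (∀ r, Disjoint (C r) A) ∧ (∀ a ∈ A, -a ∈ A) ∧ 0 ∉ A ∧
      Fintype.card Γ ≤ #A + ∑ r, #(C r) + 1 := by
  classical
  set t := Fintype.card κ with ht
  obtain ⟨f, hf⟩ := exists_isTripleSystem h2 (t / 2) (by omega)
  have hN := hf.card_freeElements h2
  let e : κ ≃ (Fin (t / 2) × Bool) ⊕ Fin (t % 2) := Fintype.equivOfCardEq (by
    simp only [Fintype.card_sum, Fintype.card_prod, Fintype.card_fin, Fintype.card_bool]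
    omega)
  let D : (Fin (t / 2) × Bool) ⊕ Fin (t % 2) → Finset Γ :=
    Sum.elim (fun s => univ.image fun j => bif s.2 then f s.1 j else -f s.1 j) fun _ => {0}
  have hinj : ∀ s : Fin (t / 2) × Bool,
      Function.Injective fun j => bif s.2 then f s.1 j else -f s.1 j := by
    rintro ⟨i, _ | _⟩ j j' h
    · exact (hf.2.2 i j i j' (Or.inl (neg_injective h))).2
    · exact (hf.2.2 i j i j' (Or.inl h)).2
  have hcard : ∀ s, #(D (Sum.inl s)) = 3 := fun s => by
    simp only [D, Sum.elim_inl]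
    rw [card_image_of_injective _ (hinj s), card_univ, Fintype.card_fin]
  have hself : ∀ i j i' j', f i j ≠ -f i' j' := fun i j i' j' h => by
    obtain ⟨rfl, rfl⟩ := hf.2.2 i j i' j' (Or.inr h)
    exact hf.2.1 i j (h2 _ (eq_neg_iff_add_eq_zero.1 h))
  have hD : Pairwise fun r r' => Disjoint (D r) (D r') := by
    intro r r' hr
    refine disjoint_left.2 fun x hx hx' => hr ?_
    rcases r with ⟨i, b⟩ | z <;> rcases r' with ⟨i', b'⟩ | z' <;>
      simp only [D, Sum.elim_inl, Sum.elim_inr, mem_image, mem_univ, true_and,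
        mem_singleton] at hx hx'
    · obtain ⟨j, rfl⟩ := hx
      obtain ⟨j', h⟩ := hx'
      cases b <;> cases b' <;> simp only [cond_true, cond_false] at h
      · rw [(hf.2.2 _ _ _ _ (Or.inl (neg_injective h))).1]
      · exact (hself _ _ _ _ h).elim
      · exact (hself _ _ _ _ h.symm).elim
      · rw [(hf.2.2 _ _ _ _ (Or.inl h)).1]
    · obtain ⟨j, rfl⟩ := hx
      cases b
      · exact (hf.2.1 i j (neg_eq_zero.1 hx')).elim
      · exact (hf.2.1 i j hx').elim
    · obtain ⟨j, rfl⟩ := hx'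
      cases b'
      · exact (hf.2.1 i' j (neg_eq_zero.1 hx)).elim
      · exact (hf.2.1 i' j hx).elim
    · congr 1
      ext
      omega
  refine ⟨fun r => D (e r), freeElements f, fun r => ?_, fun r => ?_,
    fun r r' hr => hD (e.injective.ne hr), fun r => ?_, fun a => neg_mem_freeElements,
    fun h => (mem_freeElements.1 h).1 rfl, ?_⟩
  · dsimp only
    rcases e r with s | z
    · rw [hcard]
      decide
    · simp [D]
  · dsimp only
    rcases e r with s | z
    · simp only [D, Sum.elim_inl]
      rw [sum_image fun _ _ _ _ h => hinj s h]
      obtain ⟨i, _ | _⟩ := s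
      · simp [hf.1]
      · simp [hf.1]
    · simp [D]
  · refine disjoint_left.2 fun x hx hx' => ?_
    rw [mem_freeElements] at hx'
    dsimp only at hx
    generalize e r = o at hx
    rcases o with ⟨i, b⟩ | z
    · simp only [D, Sum.elim_inl, mem_image, mem_univ, true_and] at hx
      obtain ⟨j, rfl⟩ := hx
      cases b
      · exact (hx'.2 i j).2 rfl
      · exact (hx'.2 i j).1 rfl
    · exact hx'.1 (by simpa [D] using hx)
  · rw [Equiv.sum_comp e fun r => #(D r), Fintype.sum_sum_type]
    simp only [hcard]
    simp only [Fintype.card_fin] at hN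
    simp [D]
    omega

theorem exists_symm_subset {Γ : Type*} [AddCommGroup Γ] (h2 : ∀ x : Γ, x + x = 0 → x = 0)
    {A : Finset Γ} (hA : ∀ a ∈ A, -a ∈ A) (hA0 : 0 ∉ A) (k : ℕ) (hk : 2 * k ≤ #A) :
    ∃ B ⊆ A, (∀ b ∈ B, -b ∈ B) ∧ #B = 2 * k := by
  classical
  induction k with
  | zero => exact ⟨∅, by simp, by simp, by simp⟩
  | succ k ih =>
    obtain ⟨B, hBA, hB, hBk⟩ := ih (by omega)
    obtain ⟨a, ha, haB⟩ := exists_mem_notMem_of_card_lt_card (s := B) (t := A) (by omega)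
    have hne : a ≠ -a := fun h => hA0 (by rwa [h2 a (eq_neg_iff_add_eq_zero.1 h)] at ha)
    have haB' : -a ∉ B := fun h => haB (by simpa using hB _ h)
    refine ⟨insert a (insert (-a) B), ?_, ?_, ?_⟩
    · exact insert_subset ha (insert_subset (hA a ha) hBA)
    · intro b hb
      rw [mem_insert, mem_insert] at hb ⊢
      rcases hb with rfl | rfl | hb
      · simp
      · simp
      · simp [hB b hb]
    · rw [card_insert_of_notMem (by simp [hne, haB]), card_insert_of_notMem haB', hBk]
      ring

theorem exists_symm_family {Γ P : Type*} [AddCommGroup Γ] (h2 : ∀ x : Γ, x + x = 0 → x = 0)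
    (d : P → ℕ) (s : Finset P) {A : Finset Γ} (hA : ∀ a ∈ A, -a ∈ A) (hA0 : 0 ∉ A)
    (hd : ∑ p ∈ s, 2 * d p ≤ #A) :
    ∃ B : P → Finset Γ, (∀ p ∈ s, B p ⊆ A ∧ (∀ b ∈ B p, -b ∈ B p) ∧ #(B p) = 2 * d p) ∧
      (s : Set P).Pairwise fun p q => Disjoint (B p) (B q) := by
  classical
  induction s using Finset.induction_on generalizing A with
  | empty => exact ⟨fun _ => ∅, by simp, by simp⟩
  | insert p s hp ih =>
    rw [sum_insert hp] at hd
    obtain ⟨B₀, hB₀A, hB₀, hcard⟩ := exists_symm_subset h2 hA hA0 (d p) (by omega)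
    obtain ⟨B, hB, hdisj⟩ := ih (A := A \ B₀) (fun a ha => by
        rw [mem_sdiff] at ha ⊢
        exact ⟨hA a ha.1, fun h => ha.2 (by simpa using hB₀ _ h)⟩)
      (fun h => hA0 (mem_sdiff.1 h).1) (by rw [card_sdiff_of_subset hB₀A]; omega)
    have hne : ∀ q ∈ s, q ≠ p := fun q hq h => hp (h ▸ hq)
    refine ⟨Function.update B p B₀, fun q hq => ?_, ?_⟩
    · rcases mem_insert.1 hq with rfl | hq
      · simpa using ⟨hB₀A, hB₀, hcard⟩
      · rw [Function.update_of_ne (hne q hq)]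
        exact ⟨(hB q hq).1.trans sdiff_subset, (hB q hq).2⟩
    · have hp' : ∀ q ∈ s, Disjoint B₀ (B q) := fun q hq => disjoint_sdiff.mono_right (hB q hq).1
      intro q hq r hr hqr
      rcases mem_insert.1 (mem_coe.1 hq) with rfl | hq' <;>
        rcases mem_insert.1 (mem_coe.1 hr) with rfl | hr'
      · exact (hqr rfl).elim
      · simpa [hne r hr'] using hp' r hr'
      · simpa [hne q hq'] using (hp' q hq').symm
      · simpa [hne q hq', hne r hr'] using hdisj hq' hr' hqr

theorem hasZeroSumFamily_of_forall_add_self {Γ P : Type*} [AddCommGroup Γ] [Fintype Γ] [Fintype P]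
    {m : P → ℕ} (hm : ∀ p, 4 ≤ m p) (hsum : ∑ p, m p + 5 ≤ Fintype.card Γ)
    (h2 : ∀ x : Γ, x + x = 0 → x = 0) : HasZeroSumFamily Γ m := by
  classical
  have hm5 : 5 * Fintype.card {p // Odd (m p)} ≤ ∑ p, m p := by
    rw [Fintype.card_subtype, mul_comm, ← smul_eq_mul]
    refine (card_nsmul_le_sum _ m 5 fun p hp => ?_).trans
      (sum_le_sum_of_subset (filter_subset _ _))
    have := hm p
    obtain ⟨r, hr⟩ := (mem_filter.1 hp).2
    omega
  obtain ⟨C, A, hC, hC0, hCC, hCA, hA, hA0, hle⟩ :=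
    exists_odd_zeroSum_cores (κ := {p // Odd (m p)}) h2 (by omega)
  let K : P → Finset Γ := fun p => if h : Odd (m p) then C ⟨p, h⟩ else ∅
  have hK : ∀ p, ∃ d, m p = #(K p) + 2 * d := fun p => by
    by_cases h : Odd (m p)
    · have h1 := hC ⟨p, h⟩
      have h3 := hm p
      obtain ⟨r, hr⟩ := id h
      obtain ⟨u, hu⟩ := h1.1
      simp only [K, dif_pos h]
      exact ⟨r - u, by omega⟩
    · obtain ⟨r, hr⟩ := Nat.not_odd_iff_even.1 h
      exact ⟨r, by simp only [K, dif_neg h, card_empty]; omega⟩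
  choose d hd using hK
  have hKsum : ∑ p, #(K p) = ∑ r, #(C r) := by
    rw [← Fintype.sum_subtype_add_sum_subtype (fun p => Odd (m p)),
      Fintype.sum_eq_zero (fun p : {p // ¬Odd (m p)} => #(K p)) fun p => by simp [K, p.2], add_zero]
    exact sum_congr rfl fun p _ => by simp [K, p.2]
  have hmsum : ∑ p, m p = ∑ p, #(K p) + ∑ p, 2 * d p := by
    rw [← sum_add_distrib]
    exact sum_congr rfl fun p _ => hd p
  obtain ⟨B, hB, hBB⟩ := exists_symm_family h2 d univ hA hA0 (by omega)
  have hKA : ∀ p, Disjoint (K p) A := fun p => by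
    by_cases h : Odd (m p)
    · simpa only [K, dif_pos h] using hCA _
    · simp [K, h]
  have hKB : ∀ p q, Disjoint (K p) (B q) := fun p q => (hKA p).mono_right (hB q (mem_univ q)).1
  refine ⟨fun p => K p ∪ B p, fun p => ?_, fun p => ?_, fun p q hpq => ?_⟩
  · rw [card_union_of_disjoint (hKB p p), (hB p (mem_univ p)).2.2, hd p]
  · have h0 : ∑ x ∈ B p, x = 0 := by
      refine h2 _ ?_
      have h1 : ∑ x ∈ B p, -x = ∑ x ∈ B p, x :=
        sum_nbij' Neg.neg Neg.neg (hB p (mem_univ p)).2.1 (hB p (mem_univ p)).2.1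
          (fun _ _ => neg_neg _) (fun _ _ => neg_neg _) fun _ _ => rfl
      nth_rewrite 2 [← h1]
      rw [sum_neg_distrib, add_neg_cancel]
    rw [sum_union (hKB p p), h0, add_zero]
    by_cases h : Odd (m p)
    · simpa only [K, dif_pos h] using hC0 _
    · simp [K, h]
  · have hKK : Disjoint (K p) (K q) := by
      by_cases h : Odd (m p) <;> by_cases h' : Odd (m q) <;> simp only [K, h, h', dite_true,
        dite_false, disjoint_empty_left, disjoint_empty_right]
      exact hCC fun h => hpq (congrArg Subtype.val h)
    dsimp only
    rw [disjoint_union_left, disjoint_union_right, disjoint_union_right]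
    exact ⟨⟨hKK, hKB p q⟩, (hKB q p).symm, hBB (mem_univ p) (mem_univ q) hpq⟩

theorem hasZeroSumFamily_of_involutions {Γ P : Type*} [AddCommGroup Γ] [Fintype Γ] [Fintype P]
    {m : P → ℕ} (hm : ∀ p, 4 ≤ m p) (hsum : ∑ p, m p + 5 ≤ Fintype.card Γ)
    (hinv : {ι : Γ | ι ≠ 0 ∧ ι + ι = 0}.ncard ≠ 1) : HasZeroSumFamily Γ m := by
  rcases Nat.eq_zero_or_pos {ι : Γ | ι ≠ 0 ∧ ι + ι = 0}.ncard with h0 | hpos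
  · rw [Set.ncard_eq_zero] at h0
    refine hasZeroSumFamily_of_forall_add_self hm hsum fun x hx => ?_
    by_contra hne
    exact h0.subset (⟨hne, hx⟩ : x ∈ {ι : Γ | ι ≠ 0 ∧ ι + ι = 0})
  · obtain ⟨H, a, b, hcard, ha, hb, hab, haa, hbb⟩ := exists_index_four (Γ := Γ) (by omega)
    obtain ⟨S, hS, hS0, hSS⟩ := hasZeroSumFamily_of_index_four (P := Option P)
      (m := fun o => o.elim (Fintype.card Γ - ∑ p, m p) m)
      (by
        rintro (_ | p)
        · dsimp only [Option.elim]
          omega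
        · exact hm p)
      (by
        rw [Fintype.sum_option]
        dsimp only [Option.elim]
        omega) hcard ha hb hab haa hbb
    exact ⟨fun p => S (some p), fun p => hS (some p), fun p => hS0 (some p),
      fun p q hpq => hSS fun h => hpq (Option.some_injective _ h)⟩

/-- Corollary (Cichacz–Suchan): any digraph of order `n` with all weakly connected components
of order at least 4 has a `Γ`-irregular labeling whenever the number of involutions of `Γ`
is not equal to 1 and `|Γ| ≥ n + 5`. -/
theorem stmt_6 {V Γ : Type*} [Fintype V] [AddCommGroup Γ] [Fintype Γ]
    (Adj : V → V → Prop) [DecidableRel Adj]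
    (hcomp : ∀ x : V, 4 ≤ {y | WReach Adj x y}.ncard)
    (hinv : {ι : Γ | ι ≠ 0 ∧ ι + ι = 0}.ncard ≠ 1)
    (hΓ : Fintype.card V + 5 ≤ Fintype.card Γ) :
    ∃ ψ : V → V → Γ, Function.Injective (vertexSum Adj ψ) := by
  classical
  refine HasZeroSumFamily.exists_injective_vertexSum Adj
    (hasZeroSumFamily_of_involutions (fun c => ?_) ?_ hinv)
  · obtain ⟨x, rfl⟩ := Quotient.exists_rep c
    refine (hcomp x).trans_eq ?_
    congr 1
    ext y
    exact ⟨fun h => (Quotient.sound h).symm, fun h => Quotient.exact h.symm⟩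
  · suffices h : ∑ c, {x | Quotient.mk (wReachSetoid Adj) x = c}.ncard = Fintype.card V by
      rwa [h]
    rw [← card_univ, card_eq_sum_card_fiberwise (f := Quotient.mk (wReachSetoid Adj)) (t := univ)
      (by simp)]
    refine sum_congr rfl fun c _ => ?_
    rw [← Set.ncard_coe_finset]
    simp
end

section
/- Let Γ be a finite abelian group with no involutions (equivalently, of odd order), and write |Γ| = 6k + s with k a nonnegative integer and s ∈ {1, 3, 5}. Then Γ \ {0} can be partitioned into k pairwise disjoint good 6-subsets and (s − 1)/2 pairwise disjoint zero-sum 2-subsets. -/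
open Finset

/-- A 6-subset `C` of an abelian group is *good* if
`C = {c, d, -c-d, -c, -d, c+d}` for some `c, d` and `C` has cardinality 6. -/
def IsGood {Γ : Type*} [AddCommGroup Γ] [DecidableEq Γ] (C : Finset Γ) : Prop :=
  C.card = 6 ∧ ∃ c d : Γ, C = {c, d, -c - d, -c, -d, c + d}

/-- The six values `c, d, -c-d, -c, -d, c+d`, indexed by `Fin 6`. -/
def hexagon {Γ : Type*} [AddCommGroup Γ] (c d : Γ) : Fin 6 → Γ :=
  ![c, d, -c - d, -c, -d, c + d]

/-- `S` is a disjoint union of good 6-subsets. -/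
def HasGoodPartition {Γ : Type*} [AddCommGroup Γ] [DecidableEq Γ] (S : Finset Γ) : Prop :=
  ∃ P : Finset (Finset Γ), (∀ C ∈ P, IsGood C) ∧ (P : Set (Finset Γ)).PairwiseDisjoint id ∧
    P.biUnion id = S

/-- All but at most five elements of `Γ`, including `0`, are covered by disjoint good 6-subsets. -/
def HasSkolemPartition (Γ : Type*) [AddCommGroup Γ] [Fintype Γ] [DecidableEq Γ] : Prop :=
  ∃ S : Finset Γ, 0 ∉ S ∧ HasGoodPartition S ∧ Fintype.card Γ < S.card + 6

section Basic

variable {Γ K : Type*} [AddCommGroup Γ] [AddCommGroup K]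

theorem map_hexagon (f : Γ →+ K) (c d : Γ) (i : Fin 6) :
    f (hexagon c d i) = hexagon (f c) (f d) i := by
  fin_cases i <;> simp [hexagon]

theorem injective_hexagon (hinv : ∀ g : Γ, g + g = 0 → g = 0) {c d : Γ} (hc : c ≠ 0)
    (hd : d ≠ 0) (hcd : c + d ≠ 0) (hne : c ≠ d) (h₁ : c + c + d ≠ 0) (h₂ : c + d + d ≠ 0) :
    Function.Injective (hexagon c d) := by
  have hc2 : c + c ≠ 0 := fun h => hc (hinv _ h)
  have hd2 : d + d ≠ 0 := fun h => hd (hinv _ h)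
  have hcd2 : (c + d) + (c + d) ≠ 0 := fun h => hcd (hinv _ h)
  have key : ∀ i j : Fin 6, i < j → hexagon c d i ≠ hexagon c d j := by
    intro i j hij h
    fin_cases i <;> fin_cases j <;> simp [hexagon] at hij h <;> grind
  intro i j h
  by_contra hij
  rcases lt_or_gt_of_ne hij with hlt | hlt
  · exact key i j hlt h
  · exact key j i hlt h.symm

theorem injective_add_self (hinv : ∀ g : Γ, g + g = 0 → g = 0) :
    Function.Injective fun g : Γ => g + g := fun a b h => by
  have : (a - b) + (a - b) = 0 := by
    simp only at h
    rw [sub_add_sub_comm, h, sub_self]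
  exact sub_eq_zero.1 (hinv _ this)

theorem eq_zero_of_add_self_eq_zero_of_surjective [Finite Γ]
    (hinv : ∀ g : Γ, g + g = 0 → g = 0) (f : Γ →+ K) (hf : Function.Surjective f) (x : K)
    (hx : x + x = 0) : x = 0 := by
  have : Finite K := Finite.of_surjective f hf
  have hsurj : Function.Surjective fun g : K => g + g := fun y => by
    obtain ⟨z, rfl⟩ := hf y
    obtain ⟨u, hu⟩ := Finite.surjective_of_injective (injective_add_self hinv) z
    exact ⟨f u, by simp only at hu ⊢; rw [← hu, map_add]⟩
  exact Finite.injective_iff_surjective.2 hsurj (by simpa using hx)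

variable [DecidableEq Γ] [DecidableEq K]

theorem image_hexagon (c d : Γ) :
    univ.image (hexagon c d) = {c, d, -c - d, -c, -d, c + d} := by
  ext x
  simp [hexagon, Fin.exists_fin_succ, eq_comm]

theorem isGood_image_hexagon {c d : Γ} (h : Function.Injective (hexagon c d)) :
    IsGood (univ.image (hexagon c d)) :=
  ⟨by simp [card_image_of_injective _ h], c, d, image_hexagon c d⟩

theorem IsGood.exists_hexagon {C : Finset Γ} (hC : IsGood C) :
    ∃ c d : Γ, Function.Injective (hexagon c d) ∧ C = univ.image (hexagon c d) := by
  obtain ⟨h6, c, d, rfl⟩ := hC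
  refine ⟨c, d, ?_, (image_hexagon c d).symm⟩
  rw [← image_hexagon] at h6
  rw [← Set.injOn_univ, ← coe_univ, ← card_image_iff, h6, card_univ, Fintype.card_fin]

theorem IsGood.neg_mem {C : Finset Γ} (hC : IsGood C) {x : Γ} (hx : x ∈ C) : -x ∈ C := by
  obtain ⟨-, c, d, rfl⟩ := hC
  simp only [mem_insert, mem_singleton] at hx ⊢
  rcases hx with rfl | rfl | rfl | rfl | rfl | rfl <;> simp [add_comm, sub_eq_add_neg]

namespace HasGoodPartition

theorem of_isGood {C : Finset Γ} (hC : IsGood C) : HasGoodPartition C :=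
  ⟨{C}, by simpa using hC, by simp, by simp⟩

theorem empty : HasGoodPartition (∅ : Finset Γ) := ⟨∅, by simp, by simp, by simp⟩

theorem union {S T : Finset Γ} (hS : HasGoodPartition S) (hT : HasGoodPartition T)
    (hd : Disjoint S T) : HasGoodPartition (S ∪ T) := by
  obtain ⟨P, hP, hPd, rfl⟩ := hS
  obtain ⟨R, hR, hRd, rfl⟩ := hT
  refine ⟨P ∪ R, ?_, ?_, ?_⟩
  · intro C hC
    rcases mem_union.1 hC with h | h
    exacts [hP C h, hR C h]
  · rw [coe_union, Set.pairwiseDisjoint_union]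
    refine ⟨hPd, hRd, fun C hC D hD _ => ?_⟩
    exact disjoint_of_subset_left (subset_biUnion_of_mem id hC)
      (disjoint_of_subset_right (subset_biUnion_of_mem id hD) hd)
  · rw [union_biUnion]

theorem biUnion {ι : Type*} {s : Finset ι} {F : ι → Finset Γ}
    (hF : ∀ i ∈ s, HasGoodPartition (F i)) (hd : (s : Set ι).PairwiseDisjoint F) :
    HasGoodPartition (s.biUnion F) := by
  classical
  induction s using Finset.induction_on with
  | empty => simpa using HasGoodPartition.empty
  | insert a s ha ih =>
    rw [biUnion_insert]
    refine (hF a (mem_insert_self a s)).union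
      (ih (fun i hi => hF i (mem_insert_of_mem hi)) (hd.subset (by simp))) ?_
    rw [disjoint_biUnion_right]
    intro i hi
    exact hd (by simp) (by simp [hi]) (by rintro rfl; exact ha hi)

theorem neg_mem {S : Finset Γ} (hS : HasGoodPartition S) {x : Γ} (hx : x ∈ S) : -x ∈ S := by
  obtain ⟨P, hP, -, rfl⟩ := hS
  obtain ⟨C, hC, hxC⟩ := mem_biUnion.1 hx
  exact mem_biUnion.2 ⟨C, hC, (hP C hC).neg_mem hxC⟩

theorem image {S : Finset Γ} (hS : HasGoodPartition S) (f : Γ →+ K)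
    (hf : Function.Injective f) : HasGoodPartition (S.image f) := by
  obtain ⟨P, hP, hPd, rfl⟩ := hS
  rw [biUnion_image]
  refine HasGoodPartition.biUnion (fun C hC => of_isGood ?_) ?_
  · obtain ⟨h6, c, d, h⟩ := hP C hC
    refine ⟨by rw [← h6]; exact card_image_of_injective _ hf, f c, f d, ?_⟩
    simp [h, image_insert]
  · intro C hC D hD hne
    exact (disjoint_image hf).2 (hPd hC hD hne)

theorem comap_of_isGood [Fintype Γ] (hinv : ∀ g : Γ, g + g = 0 → g = 0) (f : Γ →+ K)
    (hf : Function.Surjective f) {C : Finset K} (hC : IsGood C) :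
    HasGoodPartition ({x | f x ∈ C} : Finset Γ) := by
  obtain ⟨c', d', hinj, rfl⟩ := hC.exists_hexagon
  obtain ⟨c, rfl⟩ := hf c'
  obtain ⟨d, rfl⟩ := hf d'
  have hdouble := injective_add_self hinv
  have hmap : ∀ h : Γ, f h = 0 → ∀ i,
      f (hexagon (c + h) (d + h) i) = hexagon (f c) (f d) i := by
    intro h hh i
    rw [map_hexagon, map_add, map_add, hh, add_zero, add_zero]
  have hS : ({x | f x ∈ univ.image (hexagon (f c) (f d))} : Finset Γ) =
      ({h | f h = 0} : Finset Γ).biUnion fun h => univ.image (hexagon (c + h) (d + h)) := by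
    ext x
    simp only [mem_filter, mem_univ, true_and, mem_image, mem_biUnion]
    constructor
    · rintro ⟨i, hi⟩
      obtain ⟨u, hu⟩ := (Finite.surjective_of_injective hdouble) (-c - d - x)
      obtain ⟨v, hv⟩ := (Finite.surjective_of_injective hdouble) (x - c - d)
      have half := fun w => eq_zero_of_add_self_eq_zero_of_surjective hinv f hf (f w)
      fin_cases i <;> simp [hexagon] at hi
      · exact ⟨x - c, by simp [hi], 0, by simp [hexagon]⟩
      · exact ⟨x - d, by simp [hi], 1, by simp [hexagon]⟩
      · refine ⟨u, half u ?_, 2, ?_⟩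
        · have := congrArg f hu
          simp [← hi] at this
          exact this
        · have : x = -c - d - (u + u) := by simp only at hu; rw [hu]; abel
          rw [this]; simp [hexagon]; abel
      · exact ⟨-x - c, by simp [← hi], 3, by simp [hexagon]⟩
      · exact ⟨-x - d, by simp [← hi], 4, by simp [hexagon]⟩
      · refine ⟨v, half v ?_, 5, ?_⟩
        · have := congrArg f hv
          simp [← hi] at this
          exact this
        · have : x = c + d + (v + v) := by simp only at hv; rw [hv]; abel
          rw [this]; simp [hexagon]; abel
    · rintro ⟨h, hh, i, rfl⟩
      exact ⟨i, (hmap h hh i).symm⟩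
  rw [hS]
  refine HasGoodPartition.biUnion (fun h hh => of_isGood (isGood_image_hexagon ?_)) ?_
  · simp only [mem_filter, mem_univ, true_and] at hh
    intro i j hij
    exact hinj (by rw [← hmap h hh i, ← hmap h hh j, hij])
  · intro h hh h' hh' hne
    simp only [coe_filter, mem_univ, true_and, Set.mem_ofPred_eq] at hh hh'
    refine disjoint_left.2 fun x hx hx' => hne ?_
    obtain ⟨i, -, rfl⟩ := mem_image.1 hx
    obtain ⟨j, -, hj⟩ := mem_image.1 hx'
    obtain rfl : i = j := hinj (by rw [← hmap h hh i, ← hmap h' hh' j, hj])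
    refine hdouble ?_
    fin_cases i <;> simp [hexagon] at hj ⊢ <;> grind

theorem comap [Fintype Γ] (hinv : ∀ g : Γ, g + g = 0 → g = 0) (f : Γ →+ K)
    (hf : Function.Surjective f) {S : Finset K} (hS : HasGoodPartition S) :
    HasGoodPartition ({x | f x ∈ S} : Finset Γ) := by
  obtain ⟨P, hP, hPd, rfl⟩ := hS
  have : ({x | f x ∈ P.biUnion id} : Finset Γ) =
      P.biUnion fun C => ({x | f x ∈ C} : Finset Γ) := by
    ext x
    simp
  rw [this]
  refine HasGoodPartition.biUnion (fun C hC => comap_of_isGood hinv f hf (hP C hC)) ?_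
  intro C hC D hD hne
  refine disjoint_left.2 fun x hx hx' => ?_
  simp only [mem_filter, mem_univ, true_and] at hx hx'
  exact disjoint_left.1 (hPd hC hD hne) hx hx'

/-- If `ω` is an automorphism with `ω² + ω + 1 = 0`, then the orbits of `-ω` are good. -/
theorem of_cube_root (h2 : ∀ g : Γ, g + g = 0 → g = 0) (h3 : ∀ g : Γ, g + g + g = 0 → g = 0)
    (ω : Γ →+ Γ) (hω : ∀ x, ω (ω x) = -x - ω x) (S : Finset Γ) (h0 : 0 ∉ S)
    (hneg : ∀ x ∈ S, -x ∈ S) (hmap : ∀ x ∈ S, ω x ∈ S) : HasGoodPartition S := by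
  induction S using Finset.strongInduction with
  | H S ih =>
    rcases S.eq_empty_or_nonempty with rfl | ⟨x, hx⟩
    · exact HasGoodPartition.empty
    have hx0 : x ≠ 0 := by rintro rfl; exact h0 hx
    have hinj : Function.Injective (hexagon x (ω x)) := by
      have e := hω x
      refine injective_hexagon h2 hx0 ?_ ?_ ?_ ?_ ?_
      all_goals intro h; apply hx0
      · rw [h] at e; simpa [eq_comm] using e
      · have : ω x = -x := by rw [← add_eq_zero_iff_eq_neg, add_comm, h]
        rw [this, map_neg, this] at e; simpa using e
      · rw [← h, ← h] at e; apply h3; grind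
      · have : ω x = -x - x := by grind
        rw [this, map_sub, map_neg, this] at e; apply h3; grind
      · have : ω (x + ω x + ω x) = 0 := by rw [h, map_zero]
        rw [map_add, map_add, e] at this
        apply h3
        grind
    set C := univ.image (hexagon x (ω x)) with hC
    have hCg : IsGood C := isGood_image_hexagon hinj
    have memC : ∀ y, y ∈ C ↔ y = x ∨ y = ω x ∨ y = -x - ω x ∨ y = -x ∨ y = -ω x ∨ y = x + ω x := by
      intro y; rw [hC, image_hexagon]; simp
    have hCS : C ⊆ S := by
      intro y hy
      have h₂ := hmap _ (hmap _ hx)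
      rw [hω] at h₂
      rcases (memC y).1 hy with rfl | rfl | rfl | rfl | rfl | rfl
      · exact hx
      · exact hmap _ hx
      · exact h₂
      · exact hneg _ hx
      · exact hneg _ (hmap _ hx)
      · simpa [add_comm] using hneg _ h₂
    have hωC : ∀ y, ω y ∈ C → y ∈ C := by
      intro y hy
      have hy' : y = - ω y - ω (ω y) := by rw [hω]; abel
      rw [memC] at hy ⊢
      rcases hy with h | h | h | h | h | h <;> rw [h] at hy' <;> try simp [hω] at hy'
      all_goals rw [hy']; simp [add_comm, sub_eq_add_neg]
    rw [← union_sdiff_of_subset hCS]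
    refine (of_isGood hCg).union (ih _ ?_ ?_ ?_ ?_) disjoint_sdiff
    · exact sdiff_ssubset hCS ⟨x, (memC x).2 (Or.inl rfl)⟩
    · simp [h0]
    · intro y hy
      rw [mem_sdiff] at hy ⊢
      exact ⟨hneg _ hy.1, fun h => hy.2 (by simpa using hCg.neg_mem h)⟩
    · intro y hy
      rw [mem_sdiff] at hy ⊢
      exact ⟨hmap _ hy.1, fun h => hy.2 (hωC y h)⟩

end HasGoodPartition

end Basic

section Cyclic

/-- The triples `a i, b i, a i + b i` for `i < k` consist of `3 * k` numbers between `1` and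
`N - 1` that are pairwise distinct modulo `N` up to sign. -/
def IsDifferenceFamily (N k : ℕ) (a b : ℕ → ℕ) : Prop :=
  (∀ i < k, 0 < a i ∧ a i < b i ∧ a i + b i < N) ∧
  ∀ i < k, ∀ j < k, ∀ u v, (u = a i ∨ u = b i ∨ u = a i + b i) →
    (v = a j ∨ v = b j ∨ v = a j + b j) → u + v ≠ N ∧ (u = v → i = j)

theorem isDifferenceFamily_nested {N k : ℕ} (hN : 6 * k + 3 ≤ N) :
    IsDifferenceFamily N k (fun i => i + 1) fun i =>
      if (i + 1) % 2 = 1 then k + (k + 1) / 2 - (i + 1) / 2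
      else k + 2 * ((k + 1) / 2) + 1 + k / 2 - (i + 1) / 2 := by
  refine ⟨fun i hi => ?_, fun i hi j hj u v hu hv => ?_⟩
  · dsimp only
    split_ifs <;> omega
  · dsimp only at hu hv
    obtain ⟨t, rfl | rfl⟩ := Nat.even_or_odd' k <;> split_ifs at hu hv <;>
      rcases hu with rfl | rfl | rfl <;> rcases hv with rfl | rfl | rfl <;> omega

theorem isDifferenceFamily_peltesohn_one (s : ℕ) :
    IsDifferenceFamily (18 * s + 1) (3 * s) (fun i => i + 1) fun i =>
      if i + 1 = 3 * s then 3 * s + 1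
      else if i % 3 = 0 then 4 * s + 1 - i / 3
      else if i % 3 = 1 then 8 * s - i / 3
      else 6 * s - 1 - 2 * (i / 3) := by
  refine ⟨fun i hi => ?_, fun i hi j hj u v hu hv => ?_⟩
  · dsimp only
    split_ifs <;> omega
  · dsimp only at hu hv
    split_ifs at hu hv <;> rcases hu with rfl | rfl | rfl <;> rcases hv with rfl | rfl | rfl <;>
      omega

theorem isDifferenceFamily_peltesohn_seven (s : ℕ) :
    IsDifferenceFamily (18 * s + 7) (3 * s + 1) (fun i => i + 1) fun i =>
      if i = 3 * s then 4 * s + 2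
      else if i % 3 = 0 then 8 * s + 3 - i / 3
      else if i % 3 = 1 then 6 * s + 1 - 2 * (i / 3)
      else 4 * s + 1 - i / 3 := by
  refine ⟨fun i hi => ?_, fun i hi j hj u v hu hv => ?_⟩
  · dsimp only
    split_ifs <;> omega
  · dsimp only at hu hv
    split_ifs at hu hv <;> rcases hu with rfl | rfl | rfl <;> rcases hv with rfl | rfl | rfl <;>
      omega

theorem isDifferenceFamily_peltesohn_thirteen (s : ℕ) :
    IsDifferenceFamily (18 * s + 13) (3 * s + 2) (fun i => i + 1) fun i =>
      if i = 3 * s + 1 then 7 * s + 5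
      else if i % 3 = 0 then 4 * s + 3 - i / 3
      else if i % 3 = 1 then 6 * s + 3 - 2 * (i / 3)
      else 8 * s + 5 - i / 3 := by
  refine ⟨fun i hi => ?_, fun i hi j hj u v hu hv => ?_⟩
  · dsimp only
    split_ifs <;> omega
  · dsimp only at hu hv
    split_ifs at hu hv <;> rcases hu with rfl | rfl | rfl <;> rcases hv with rfl | rfl | rfl <;>
      omega

theorem exists_isDifferenceFamily {N : ℕ} (hN : Odd N) :
    ∃ k a b, IsDifferenceFamily N k a b ∧ N < 6 * k + 6 := by
  obtain ⟨m, rfl⟩ := hN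
  by_cases h : 6 * ((2 * m + 1) / 6) + 3 ≤ 2 * m + 1
  · exact ⟨_, _, _, isDifferenceFamily_nested h, by omega⟩
  · have h18 : m = 9 * (m / 9) ∨ m = 9 * (m / 9) + 3 ∨ m = 9 * (m / 9) + 6 := by omega
    generalize m / 9 = s at h18
    rcases h18 with rfl | rfl | rfl
    · rw [show 2 * (9 * s) + 1 = 18 * s + 1 by ring]
      exact ⟨_, _, _, isDifferenceFamily_peltesohn_one s, by omega⟩
    · rw [show 2 * (9 * s + 3) + 1 = 18 * s + 7 by ring]
      exact ⟨_, _, _, isDifferenceFamily_peltesohn_seven s, by omega⟩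
    · rw [show 2 * (9 * s + 6) + 1 = 18 * s + 13 by ring]
      exact ⟨_, _, _, isDifferenceFamily_peltesohn_thirteen s, by omega⟩

theorem IsDifferenceFamily.hasSkolemPartition {N k : ℕ} [NeZero N] (hN : Odd N) {a b : ℕ → ℕ}
    (h : IsDifferenceFamily N k a b) (hk : N < 6 * k + 6) : HasSkolemPartition (ZMod N) := by
  obtain ⟨hlt, hne⟩ := h
  have hzero : ∀ u : ℕ, 0 < u → u < 2 * N → u ≠ N → (u : ZMod N) ≠ 0 := by
    intro u h0 h1 h2 h
    obtain ⟨c, rfl⟩ := (ZMod.natCast_eq_zero_iff u N).1 h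
    have : c < 2 := by
      by_contra! hc
      nlinarith
    interval_cases c <;> simp_all
  have hinj : ∀ i < k, Function.Injective (hexagon (a i : ZMod N) (b i)) := by
    intro i hi
    obtain ⟨h1, h2, h3⟩ := hlt i hi
    have hac := (hne i hi i hi (a i) (a i + b i) (by simp) (by simp)).1
    have hbc := (hne i hi i hi (b i) (a i + b i) (by simp) (by simp)).1
    refine injective_hexagon (fun g hg => (ZMod.add_self_eq_zero_iff_eq_zero hN).1 hg)
      (hzero _ ?_ ?_ ?_) (hzero _ ?_ ?_ ?_) ?_ ?_ ?_ ?_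
    any_goals omega
    · exact_mod_cast hzero (a i + b i) (by omega) (by omega) (by omega)
    · intro h
      rw [ZMod.natCast_eq_natCast_iff', Nat.mod_eq_of_lt (by omega),
        Nat.mod_eq_of_lt (by omega)] at h
      omega
    · exact_mod_cast hzero (a i + a i + b i) (by omega) (by omega) (by omega)
    · exact_mod_cast hzero (a i + b i + b i) (by omega) (by omega) (by omega)
  have hmem : ∀ i < k, ∀ x ∈ univ.image (hexagon (a i : ZMod N) (b i)), ∃ u : ℕ,
      (u = a i ∨ u = b i ∨ u = a i + b i) ∧ 0 < u ∧ u < N ∧ (x = u ∨ x = -u) := by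
    intro i hi x hx
    obtain ⟨h1, h2, h3⟩ := hlt i hi
    rw [image_hexagon] at hx
    simp only [mem_insert, mem_singleton] at hx
    rcases hx with rfl | rfl | rfl | rfl | rfl | rfl
    · exact ⟨a i, by simp, by omega, by omega, by simp⟩
    · exact ⟨b i, by simp, by omega, by omega, by simp⟩
    · exact ⟨a i + b i, by simp, by omega, by omega, .inr (by push_cast; ring)⟩
    · exact ⟨a i, by simp, by omega, by omega, by simp⟩
    · exact ⟨b i, by simp, by omega, by omega, by simp⟩
    · exact ⟨a i + b i, by simp, by omega, by omega, by simp⟩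
  have hdisj : (range k : Set ℕ).PairwiseDisjoint
      fun i => univ.image (hexagon (a i : ZMod N) (b i)) := by
    intro i hi j hj hij
    rw [mem_coe, mem_range] at hi hj
    refine disjoint_left.2 fun x hx hx' => hij ?_
    obtain ⟨u, hu, hu0, huN, hxu⟩ := hmem i hi x hx
    obtain ⟨v, hv, hv0, hvN, hxv⟩ := hmem j hj x hx'
    obtain ⟨h1, h2⟩ := hne i hi j hj u v hu hv
    have huv : (u : ZMod N) ≠ -v := fun h =>
      hzero (u + v) (by omega) (by omega) h1 (by push_cast; rw [h, neg_add_cancel])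
    have huv' : (u : ZMod N) = v := by
      rcases hxu with rfl | rfl <;> rcases hxv with h | h
      · exact h
      · exact absurd h huv
      · exact absurd (neg_eq_iff_eq_neg.1 h) huv
      · exact neg_injective h
    rw [ZMod.natCast_eq_natCast_iff', Nat.mod_eq_of_lt huN, Nat.mod_eq_of_lt hvN] at huv'
    exact h2 huv'
  refine ⟨(range k).biUnion fun i => univ.image (hexagon (a i : ZMod N) (b i)), ?_,
    HasGoodPartition.biUnion (fun i hi => .of_isGood (isGood_image_hexagon
      (hinj i (mem_range.1 hi)))) hdisj, ?_⟩
  · rw [mem_biUnion]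
    rintro ⟨i, hi, hx⟩
    obtain ⟨u, -, hu0, huN, hxu⟩ := hmem i (mem_range.1 hi) 0 hx
    exact hzero u hu0 (by omega) (by omega) (by simpa [eq_comm] using hxu)
  · rw [card_biUnion hdisj, ZMod.card, sum_congr rfl fun i hi =>
      card_image_of_injective _ (hinj i (mem_range.1 hi))]
    simp
    omega

end Cyclic

section Reduction

variable {Γ : Type*} [AddCommGroup Γ] [Fintype Γ] [DecidableEq Γ]

theorem HasSkolemPartition.of_addEquiv {K : Type*} [AddCommGroup K] [Fintype K] [DecidableEq K]
    (h : HasSkolemPartition K) (e : K ≃+ Γ) : HasSkolemPartition Γ := by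
  obtain ⟨S, h0, hS, hcard⟩ := h
  refine ⟨S.image e, by simpa using h0, hS.image e.toAddMonoidHom e.injective, ?_⟩
  rwa [card_image_of_injective _ e.injective, ← Fintype.card_congr e.toEquiv]

theorem HasSkolemPartition.of_surjective {K : Type*} [AddCommGroup K] [DecidableEq K]
    (hinv : ∀ g : Γ, g + g = 0 → g = 0) (f : Γ →+ K) (hf : Function.Surjective f)
    (V : AddSubgroup K) (T : Finset K) (hT : HasGoodPartition T) (hTV : ∀ x, x ∈ T ↔ x ∉ V)
    [Fintype (V.comap f)] [DecidableEq (V.comap f)] (hV : HasSkolemPartition (V.comap f)) :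
    HasSkolemPartition Γ := by
  obtain ⟨S, h0, hS, hcard⟩ := hV
  have hdisj : Disjoint (S.image (V.comap f).subtype) ({x | f x ∈ T} : Finset Γ) := by
    refine disjoint_left.2 fun x hx hx' => ?_
    obtain ⟨y, -, rfl⟩ := mem_image.1 hx
    exact (hTV _).1 (mem_filter.1 hx').2 y.2
  refine ⟨S.image (V.comap f).subtype ∪ ({x | f x ∈ T} : Finset Γ), ?_,
    (hS.image _ Subtype.val_injective).union (hT.comap hinv f hf) hdisj, ?_⟩
  · simpa [hTV] using h0
  · have hH : Fintype.card (V.comap f) = #({x | f x ∉ T} : Finset Γ) := by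
      rw [Fintype.card_of_subtype]
      intro x
      simp [hTV]
    have := card_filter_add_card_filter_not (s := (univ : Finset Γ)) (fun x => f x ∈ T)
    rw [card_union_of_disjoint hdisj, card_image_of_injective _ (V.comap f).subtype_injective]
    rw [card_univ] at this
    omega

/-- A finite abelian group is cyclic or has a quotient `ZMod p × ZMod p`. -/
theorem exists_addEquiv_zmod_or_surjective (Γ : Type*) [AddCommGroup Γ] [Finite Γ] :
    (∃ N : ℕ, Nonempty (ZMod N ≃+ Γ)) ∨
      ∃ (p : ℕ) (_ : p.Prime) (f : Γ →+ ZMod p × ZMod p), Function.Surjective f := by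
  classical
  obtain ⟨ι, _, n, -, ⟨e⟩⟩ := AddCommGroup.equiv_directSum_zmod_of_finite' Γ
  let e' : Γ ≃+ ∀ i, ZMod (n i) := e.trans (DirectSum.addEquivProd _)
  by_cases hn : Pairwise (Function.onFun Nat.Coprime n)
  · exact .inl ⟨_, ⟨(ZMod.prodEquivPi n hn).toAddEquiv.trans e'.symm⟩⟩
  · obtain ⟨i, j, hij, h⟩ : ∃ i j, i ≠ j ∧ ¬ Nat.Coprime (n i) (n j) := by
      simpa [Pairwise, Function.onFun] using hn
    obtain ⟨p, hp, hi, hj⟩ := Nat.Prime.not_coprime_iff_dvd.1 h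
    let g : (∀ i, ZMod (n i)) →+ ZMod p × ZMod p :=
      ((ZMod.castHom hi (ZMod p)).toAddMonoidHom.comp (Pi.evalAddMonoidHom _ i)).prod
        ((ZMod.castHom hj (ZMod p)).toAddMonoidHom.comp (Pi.evalAddMonoidHom _ j))
    have hg : Function.Surjective g := by
      rintro ⟨x, y⟩
      obtain ⟨x', hx⟩ := ZMod.castHom_surjective hi x
      obtain ⟨y', hy⟩ := ZMod.castHom_surjective hj y
      refine ⟨Function.update (Function.update 0 i x') j y', Prod.ext ?_ ?_⟩
      · change ZMod.castHom hi (ZMod p) (Function.update (β := fun l => ZMod (n l))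
          (Function.update 0 i x') j y' i) = x
        rw [Function.update_of_ne hij, Function.update_self, hx]
      · change ZMod.castHom hj (ZMod p) (Function.update (β := fun l => ZMod (n l))
          (Function.update 0 i x') j y' j) = y
        rw [Function.update_self, hy]
    exact .inr ⟨p, hp, g.comp e'.toAddMonoidHom, hg.comp e'.surjective⟩

theorem hasGoodPartition_zmod_prod_self {p : ℕ} (hp : p.Prime) [NeZero p] (hp3 : p ≠ 3)
    (h2 : ∀ x : ZMod p × ZMod p, x + x = 0 → x = 0) :
    HasGoodPartition (univ.erase (0 : ZMod p × ZMod p)) := by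
  have : Fact p.Prime := ⟨hp⟩
  have h3 : (3 : ZMod p) ≠ 0 := by
    intro h
    have : p ∣ 3 := (ZMod.natCast_eq_zero_iff 3 p).1 (by exact_mod_cast h)
    exact hp3 ((Nat.prime_dvd_prime_iff_eq hp Nat.prime_three).1 this)
  let ω : ZMod p × ZMod p →+ ZMod p × ZMod p :=
    (-AddMonoidHom.snd _ _).prod (AddMonoidHom.fst _ _ - AddMonoidHom.snd _ _)
  have hω : ∀ x, ω (ω x) = -x - ω x := by
    rintro ⟨x, y⟩
    simp [ω, sub_eq_add_neg, add_comm]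
  refine HasGoodPartition.of_cube_root h2 ?_ ω hω _ (by simp) (by simp) ?_
  · rintro ⟨x, y⟩ h
    simp only [Prod.mk_add_mk, Prod.mk_eq_zero] at h ⊢
    have aux : ∀ z : ZMod p, z + z + z = 0 → z = 0 := fun z hz =>
      (mul_eq_zero.1 (show 3 * z = 0 by rw [← hz]; ring)).resolve_left h3
    exact ⟨aux x h.1, aux y h.2⟩
  · intro x hx
    simp only [mem_erase, mem_univ, and_true] at hx ⊢
    intro h
    have := hω x
    rw [h, map_zero, sub_zero, eq_comm, neg_eq_zero] at this
    exact hx this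

theorem hasGoodPartition_zmod_three_prod_self :
    HasGoodPartition ({x | x.1 ≠ 0} : Finset (ZMod 3 × ZMod 3)) :=
  .of_isGood ⟨by decide, (1, 0), (1, 1), by decide⟩

end Reduction

theorem hasSkolemPartition_of_no_involution.{u} (Γ : Type u) [AddCommGroup Γ] [Fintype Γ]
    [DecidableEq Γ] (hinv : ∀ g : Γ, g + g = 0 → g = 0) : HasSkolemPartition Γ := by
  induction hn : Fintype.card Γ using Nat.strong_induction_on generalizing Γ with
  | _ n ih =>
    rcases exists_addEquiv_zmod_or_surjective Γ with ⟨N, ⟨e⟩⟩ | ⟨p, hp, f, hf⟩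
    · have : Finite (ZMod N) := Finite.of_equiv Γ e.symm.toEquiv
      have hN0 : N ≠ 0 := by
        rintro rfl
        exact Infinite.not_finite (α := ℤ) this
      have : NeZero N := ⟨hN0⟩
      have hN : Odd N := by
        by_contra hN
        obtain ⟨m, rfl⟩ := Nat.not_odd_iff_even.1 hN
        have h := hinv (e (m : ZMod (m + m))) (by
          rw [← map_add, ← Nat.cast_add, ZMod.natCast_self, map_zero])
        rw [map_eq_zero_iff _ e.injective, ZMod.natCast_eq_zero_iff] at h
        have := Nat.le_of_dvd (by omega) h
        omega
      obtain ⟨k, a, b, h, hk⟩ := exists_isDifferenceFamily hN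
      exact (h.hasSkolemPartition hN hk).of_addEquiv e
    · classical
      have : NeZero p := ⟨hp.ne_zero⟩
      have : Fact p.Prime := ⟨hp⟩
      obtain ⟨V, T, hT, hTV, x, hx⟩ : ∃ (V : AddSubgroup (ZMod p × ZMod p))
          (T : Finset (ZMod p × ZMod p)), HasGoodPartition T ∧ (∀ x, x ∈ T ↔ x ∉ V) ∧
            ∃ x, x ∉ V := by
        by_cases hp3 : p = 3
        · subst hp3
          exact ⟨AddSubgroup.prod ⊥ ⊤, _, hasGoodPartition_zmod_three_prod_self,
            fun x => by simp [AddSubgroup.mem_prod], (1, 0), by simp [AddSubgroup.mem_prod]⟩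
        · exact ⟨⊥, _, hasGoodPartition_zmod_prod_self hp hp3
            (eq_zero_of_add_self_eq_zero_of_surjective hinv f hf), fun x => by simp, (1, 0), by simp⟩
      obtain ⟨y, rfl⟩ := hf x
      refine HasSkolemPartition.of_surjective hinv f hf V T hT hTV (ih _ ?_ _ ?_ rfl)
      · rw [← hn]
        exact Fintype.card_subtype_lt (p := fun z => z ∈ V.comap f) (x := y) hx
      · intro g hg
        exact Subtype.ext (hinv g (congrArg Subtype.val hg))

theorem exists_zero_sum_pairs {Γ : Type*} [AddCommGroup Γ] [DecidableEq Γ]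
    (hinv : ∀ g : Γ, g + g = 0 → g = 0) (m : ℕ) (T : Finset Γ) (hT : #T = 2 * m) (h0 : 0 ∉ T)
    (hneg : ∀ x ∈ T, -x ∈ T) :
    ∃ B : Fin m → Finset Γ, (∀ j, #(B j) = 2 ∧ ∑ x ∈ B j, x = 0) ∧
      (∀ i j, i ≠ j → Disjoint (B i) (B j)) ∧ univ.biUnion B = T := by
  induction m generalizing T with
  | zero =>
    obtain rfl : T = ∅ := card_eq_zero.1 (by simpa using hT)
    exact ⟨Fin.elim0, fun j => j.elim0, fun j => j.elim0, by simp⟩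
  | succ m ih =>
    obtain ⟨x, hx⟩ : T.Nonempty := card_pos.1 (by omega)
    have hne : x ≠ -x := by
      intro h
      have : x = 0 := hinv x (by nth_rw 1 [h]; exact neg_add_cancel x)
      exact h0 (this ▸ hx)
    have hsub : {x, -x} ⊆ T := by
      simp [insert_subset_iff, hx, hneg x hx]
    obtain ⟨B, hB, hd, hU⟩ := ih (T \ {x, -x})
      (by rw [card_sdiff_of_subset hsub, card_pair hne]; omega) (by simp [h0]) (by
        intro y hy
        simp only [mem_sdiff, mem_insert, mem_singleton, not_or] at hy ⊢
        exact ⟨hneg y hy.1, fun h => hy.2.2 (neg_eq_iff_eq_neg.1 h),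
          fun h => hy.2.1 (neg_injective h)⟩)
    have hxB : ∀ j, Disjoint {x, -x} (B j) := fun j =>
      disjoint_of_subset_right (hU ▸ subset_biUnion_of_mem B (mem_univ j)) disjoint_sdiff
    refine ⟨Fin.cons {x, -x} B, ?_, ?_, ?_⟩
    · intro j
      cases j using Fin.cases with
      | zero => simp [card_pair hne, sum_pair hne]
      | succ j => simpa using hB j
    · intro i j hij
      cases i using Fin.cases with
      | zero =>
        cases j using Fin.cases with
        | zero => exact absurd rfl hij
        | succ j => simpa using hxB j
      | succ i =>
        cases j using Fin.cases with
        | zero => simpa using (hxB i).symm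
        | succ j => simpa using hd i j (by rintro rfl; exact hij rfl)
    · rw [← union_sdiff_of_subset hsub, ← hU]
      ext y
      simp [Fin.exists_fin_succ, or_assoc]

/-- Theorem (Tannenbaum): a finite abelian group `Γ` with no involutions, of order
`6k + s` with `s ∈ {1, 3, 5}`, has a Skolem partition: `Γ \ {0}` can be partitioned into
`k` good 6-subsets and `(s-1)/2` zero-sum 2-subsets. -/
theorem stmt_10 {Γ : Type*} [AddCommGroup Γ] [Fintype Γ] [DecidableEq Γ]
    (hinv : ∀ g : Γ, g + g = 0 → g = 0)
    (k s : ℕ) (hs : s = 1 ∨ s = 3 ∨ s = 5) (hcard : Fintype.card Γ = 6 * k + s) :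
    ∃ (A : Fin k → Finset Γ) (B : Fin ((s - 1) / 2) → Finset Γ),
      (∀ i, IsGood (A i)) ∧
      (∀ j, (B j).card = 2 ∧ ∑ x ∈ B j, x = 0) ∧
      (∀ i j, i ≠ j → Disjoint (A i) (A j)) ∧
      (∀ i j, i ≠ j → Disjoint (B i) (B j)) ∧
      (∀ i j, Disjoint (A i) (B j)) ∧
      univ.biUnion A ∪ univ.biUnion B = univ \ {0} := by
  obtain ⟨S, h0, hS, hcardS⟩ := hasSkolemPartition_of_no_involution Γ hinv
  have hneg : ∀ x ∈ S, -x ∈ S := fun x hx => hS.neg_mem hx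
  obtain ⟨P, hP, hPd, hPS⟩ := hS
  have hS6 : #S = #P * 6 := by
    rw [← hPS, card_biUnion hPd]
    exact sum_const_nat fun C hC => (hP C hC).1
  have hlt : #(insert 0 S) ≤ Fintype.card Γ := card_le_univ _
  rw [card_insert_of_notMem h0] at hlt
  have hPk : #P = k := by omega
  subst hPk
  obtain ⟨B, hB, hBd, hBU⟩ := exists_zero_sum_pairs hinv ((s - 1) / 2) (univ \ insert 0 S)
    (by rw [card_univ_sdiff, card_insert_of_notMem h0]; omega) (by simp) (by
      intro x hx
      simp only [mem_sdiff, mem_univ, true_and, mem_insert, not_or, neg_eq_zero] at hx ⊢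
      exact ⟨hx.1, fun h => hx.2 (by simpa using hneg _ h)⟩)
  let A : Fin #P → Finset Γ := fun i => P.equivFin.symm i
  have hAU : univ.biUnion A = S := by
    rw [← hPS]
    ext x
    simp only [mem_biUnion, mem_univ, true_and, A, id]
    exact ⟨fun ⟨i, hi⟩ => ⟨_, (P.equivFin.symm i).2, hi⟩,
      fun ⟨C, hC, hx⟩ => ⟨P.equivFin ⟨C, hC⟩, by simpa using hx⟩⟩
  refine ⟨A, B, fun i => hP _ (P.equivFin.symm i).2, hB, fun i j hij => ?_, hBd,
    fun i j => ?_, ?_⟩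
  · exact hPd (P.equivFin.symm i).2 (P.equivFin.symm j).2
      fun h => hij (P.equivFin.symm.injective (Subtype.ext h))
  · refine disjoint_of_subset_left (hAU ▸ subset_biUnion_of_mem A (mem_univ i))
      (disjoint_of_subset_right (hBU ▸ subset_biUnion_of_mem B (mem_univ j)) ?_)
    exact disjoint_of_subset_left (subset_insert 0 S) disjoint_sdiff
  · rw [hAU, hBU]
    ext x
    simp only [mem_union, mem_sdiff, mem_univ, true_and, mem_insert, mem_singleton]
    have : x ∈ S → x ≠ 0 := by
      rintro hx rfl
      exact h0 hx
    tauto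
end
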